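/- arXiv:2501.17390 — 4 statements merged into one kernel-verified Lean document; each statement's English description precedes it below -/
import Mathlib

section
/- Let α ∈ (0,1) and λ > 0. For all t, s ≥ 0, E_α(−λ t^α) · E_α(−λ s^α) ≤ E_α(−λ (t+s)^α). Moreover, if in addition t·s > 0, the inequality is strict. -/
open Real MeasureTheory Set

/-- Two-parameter Mittag-Leffler function `E_{α,β}(t) = Σ t^k / Γ(α k + β)`. -/
noncomputable def mittagLeffler (α β t : ℝ) : ℝ := ∑' k : ℕ, t ^ k / Real.Gamma (α * k + β)

/-- One-parameter Mittag-Leffler function `E_α = E_{α,1}`. -/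
noncomputable def ML (α t : ℝ) : ℝ := mittagLeffler α 1 t

/-- The Riemann-Liouville integral `I^{1-α}(x - x 0)` appearing in the Caputo derivative. -/
noncomputable def caputoKernel (α : ℝ) (x : ℝ → ℝ) (s : ℝ) : ℝ :=
  (1 / Real.Gamma (1 - α)) * ∫ r in (0:ℝ)..s, (s - r) ^ (-α) * (x r - x 0)

/-- Caputo fractional derivative of order `α`. -/
noncomputable def caputo (α : ℝ) (x : ℝ → ℝ) (t : ℝ) : ℝ := deriv (caputoKernel α x) t

open Filter Topology

def VolEq (α c : ℝ) (w H : ℝ → ℝ) : Prop :=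
  ∀ t, 0 ≤ t → w t = H t - c * ∫ r in (0:ℝ)..t, (t - r) ^ (α - 1) * w r

lemma kernel_int {α : ℝ} (hα : 0 < α) {w : ℝ → ℝ} (hw : Continuous w) (T a b : ℝ) :
    IntervalIntegrable (fun r => (T - r) ^ (α - 1) * w r) volume a b := by
  have h := (intervalIntegral.intervalIntegrable_rpow' (a := T - a) (b := T - b)
    (r := α - 1) (by linarith)).comp_sub_left T
  simp only [sub_sub_cancel] at h
  exact h.mul_continuousOn hw.continuousOn

lemma vol_restart {α c : ℝ} (hα : 0 < α) {w H : ℝ → ℝ} (hw : Continuous w)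
    (h : VolEq α c w H) {a : ℝ} (ha : 0 ≤ a) :
    VolEq α c (fun t => w (a + t))
      (fun t => H (a + t) - c * ∫ r in (0:ℝ)..a, (a + t - r) ^ (α - 1) * w r) := by
  intro t ht
  have h1 := h (a + t) (by linarith)
  have h2 := intervalIntegral.integral_add_adjacent_intervals
    (kernel_int hα hw (a + t) 0 a) (kernel_int hα hw (a + t) a (a + t))
  have h3 := intervalIntegral.integral_comp_add_left (a := 0) (b := t)
    (fun r => (a + t - r) ^ (α - 1) * w r) a
  simp only [add_zero, add_sub_add_left_eq_sub] at h3
  simp only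
  rw [h1, ← h2, h3]
  ring

lemma restart_mono {α c : ℝ} (hα : 0 < α) (hα1 : α < 1) (hc : 0 ≤ c) {w H : ℝ → ℝ}
    (hw : Continuous w) {a : ℝ} (ha : 0 ≤ a) (hH : MonotoneOn H (Ici 0))
    (hp : ∀ t ∈ Icc 0 a, 0 ≤ w t) :
    MonotoneOn (fun t => H (a + t) - c * ∫ r in (0:ℝ)..a, (a + t - r) ^ (α - 1) * w r)
      (Ici 0) := by
  intro x hx y hy hxy
  simp only [mem_Ici] at hx hy
  have h1 : H (a + x) ≤ H (a + y) := hH (by simp; linarith) (by simp; linarith) (by linarith)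
  have h2 : ∫ r in (0:ℝ)..a, (a + y - r) ^ (α - 1) * w r ≤
      ∫ r in (0:ℝ)..a, (a + x - r) ^ (α - 1) * w r := by
    apply intervalIntegral.integral_mono_on_of_le_Ioo ha (kernel_int hα hw _ _ _)
      (kernel_int hα hw _ _ _)
    intro r hr
    apply mul_le_mul_of_nonneg_right _ (hp r ⟨hr.1.le, hr.2.le⟩)
    exact Real.rpow_le_rpow_of_nonpos (by linarith [hr.2]) (by linarith) (by linarith)
  have := mul_le_mul_of_nonneg_left h2 hc
  simp only
  linarith

lemma vol_local {α c : ℝ} (hα : 0 < α) (hc : 0 ≤ c) {w H : ℝ → ℝ}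
    (hw : Continuous w) (h : VolEq α c w H) (hH : MonotoneOn H (Ici 0)) (h0 : 0 < H 0)
    {δ : ℝ} (hδ : c * (δ ^ α / α) < 1) : ∀ t ∈ Icc 0 δ, 0 < w t := by
  by_contra! hcon
  have hcomp : IsCompact (Icc 0 δ ∩ {t | w t ≤ 0}) :=
    isCompact_Icc.inter_right (isClosed_le hw continuous_const)
  obtain ⟨t, ⟨⟨ht0, htδ⟩, hwt⟩, hleast⟩ := hcomp.exists_isLeast hcon
  simp only [mem_ofPred_eq] at hwt
  have hw0 : w 0 = H 0 := by simpa using h 0 le_rfl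
  have hpos : ∀ r, 0 ≤ r → r < t → 0 < w r := by
    intro r hr hrt
    by_contra! hn
    exact absurd (hleast ⟨⟨hr, by linarith⟩, hn⟩) (not_le.mpr hrt)
  have hHt : 0 < H t := h0.trans_le (hH (by simp) (by simpa using ht0) ht0)
  have hle : ∀ r ∈ Ioo 0 t, w r ≤ H t := by
    intro r hr
    have h1 := h r hr.1.le
    have h2 : 0 ≤ ∫ x in (0:ℝ)..r, (r - x) ^ (α - 1) * w x := by
      apply intervalIntegral.integral_nonneg hr.1.le
      intro x hx
      exact mul_nonneg (Real.rpow_nonneg (by linarith [hx.2]) _)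
        (hpos x hx.1 (by linarith [hx.2, hr.2])).le
    have h3 : H r ≤ H t := hH (by simpa using hr.1.le) (by simpa using ht0) hr.2.le
    have := mul_nonneg hc h2
    linarith
  have hint : ∫ r in (0:ℝ)..t, (t - r) ^ (α - 1) * w r ≤
      ∫ r in (0:ℝ)..t, (t - r) ^ (α - 1) * H t := by
    apply intervalIntegral.integral_mono_on_of_le_Ioo ht0 (kernel_int hα hw _ _ _)
      (kernel_int hα continuous_const _ _ _)
    intro r hr
    exact mul_le_mul_of_nonneg_left (hle r hr) (Real.rpow_nonneg (by linarith [hr.2]) _)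
  have hval : ∫ r in (0:ℝ)..t, (t - r) ^ (α - 1) * H t = t ^ α / α * H t := by
    rw [intervalIntegral.integral_mul_const,
      intervalIntegral.integral_comp_sub_left (fun x => x ^ (α - 1)) t,
      integral_rpow (Or.inl (by linarith))]
    simp [Real.zero_rpow hα.ne']
  have hmon : t ^ α / α ≤ δ ^ α / α := by
    gcongr
  have h1 := h t ht0
  rw [hval] at hint
  have h2 := mul_le_mul_of_nonneg_left hint hc
  have h3 : c * (t ^ α / α) < 1 := lt_of_le_of_lt (mul_le_mul_of_nonneg_left hmon hc) hδ
  nlinarith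

lemma vol_pos {α c : ℝ} (hα : 0 < α) (hα1 : α < 1) (hc : 0 ≤ c) {w H : ℝ → ℝ}
    (hw : Continuous w) (h : VolEq α c w H) (hH : MonotoneOn H (Ici 0)) (h0 : 0 < H 0) :
    ∀ t, 0 ≤ t → 0 < w t := by
  obtain ⟨δ, hδ0, hδ⟩ : ∃ δ : ℝ, 0 < δ ∧ c * (δ ^ α / α) < 1 := by
    have hcont : Continuous (fun δ : ℝ => c * (δ ^ α / α)) :=
      continuous_const.mul ((continuous_id.rpow_const (fun _ => Or.inr hα.le)).div_const _)
    have h1 : ∀ᶠ δ in 𝓝 (0:ℝ), c * (δ ^ α / α) < 1 :=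
      hcont.continuousAt.eventually_lt continuousAt_const (by simp [Real.zero_rpow hα.ne'])
    have h2 : ∀ᶠ δ in 𝓝[>] (0:ℝ), c * (δ ^ α / α) < 1 := h1.filter_mono nhdsWithin_le_nhds
    obtain ⟨δ, h3, h4⟩ := (h2.and self_mem_nhdsWithin).exists
    exact ⟨δ, h4, h3⟩
  have key : ∀ n : ℕ, ∀ t ∈ Icc 0 (n * δ), 0 < w t := by
    intro n
    induction n with
    | zero =>
      intro t ht
      have : t = 0 := by simpa using ht
      subst this
      have := h 0 le_rfl
      simp at this
      linarith
    | succ n ih =>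
      intro t ht
      by_cases htn : t ≤ n * δ
      · exact ih t ⟨ht.1, htn⟩
      push Not at htn
      have hn : (0:ℝ) ≤ n * δ := by positivity
      have hv := vol_restart hα hw h hn
      have hm := restart_mono hα hα1 hc hw hn hH (fun t ht => (ih t ht).le)
      have hwc : Continuous (fun t => w (n * δ + t)) := by fun_prop
      have hz : 0 < H (n * δ + 0) -
          c * ∫ r in (0:ℝ)..(n * δ), (n * δ + 0 - r) ^ (α - 1) * w r := by
        rw [add_zero, ← h _ hn]
        exact ih _ ⟨hn, le_rfl⟩
      have := vol_local hα hc hwc hv hm hz hδ (t - n * δ)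
        ⟨by linarith, by have := ht.2; push_cast at this; linarith⟩
      simpa using this
  intro t ht
  obtain ⟨n, hn⟩ := exists_nat_ge (t / δ)
  exact key n t ⟨ht, by rwa [div_le_iff₀ hδ0] at hn⟩

lemma vol_subadd {α c : ℝ} (hα : 0 < α) (hα1 : α < 1) (hc : 0 < c) {f : ℝ → ℝ}
    (hf : Continuous f) (h : VolEq α c f (fun _ => 1)) {t s : ℝ} (ht : 0 < t) (hs : 0 < s) :
    f t * f s < f (t + s) := by
  have fpos : ∀ t, 0 ≤ t → 0 < f t :=
    vol_pos hα hα1 hc.le hf h (fun _ _ _ _ _ => le_rfl) one_pos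
  set w : ℝ → ℝ := fun t => f (s + t) - f s * f t with hwdef
  set h' : ℝ → ℝ := fun t => 1 - c * ∫ r in (0:ℝ)..s, (s + t - r) ^ (α - 1) * f r with hh'
  have hw : Continuous w := by fun_prop
  have hfs : Continuous (fun t => f (s + t)) := by fun_prop
  have hR : VolEq α c (fun t => f (s + t)) h' := vol_restart hα hf h hs.le
  have hM : MonotoneOn h' (Ici 0) :=
    restart_mono (H := fun _ => 1) hα hα1 hc.le hf hs.le (fun _ _ _ _ _ => le_rfl)
      (fun t ht => (fpos t ht.1).le)
  have h'0 : h' 0 = f s := by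
    simp only [hh', add_zero]; exact (h s hs.le).symm
  have hV : VolEq α c w (fun t => h' t - f s) := by
    intro x hx
    have e1 := hR x hx
    have e2 := h x hx
    have e3 : ∫ r in (0:ℝ)..x, (x - r) ^ (α - 1) * w r =
        (∫ r in (0:ℝ)..x, (x - r) ^ (α - 1) * f (s + r)) -
          f s * ∫ r in (0:ℝ)..x, (x - r) ^ (α - 1) * f r := by
      rw [← intervalIntegral.integral_const_mul, ← intervalIntegral.integral_sub
        (kernel_int hα hfs _ _ _) ((kernel_int hα hf _ _ _).const_mul _)]
      congr 1; ext r; simp only [hwdef]; ring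
    rw [e3]
    simp only [hwdef] at e1 e2 ⊢
    rw [e1]
    conv_lhs => rw [e2]
    ring
  have hM' : MonotoneOn (fun t => h' t - f s) (Ici 0) :=
    fun x hx y hy hxy => sub_le_sub_right (hM hx hy hxy) _
  -- nonnegativity by perturbation
  have wnn : ∀ x, 0 ≤ x → 0 ≤ w x := by
    intro x hx
    by_contra! hneg
    set ε := - w x / f x with hε
    have hεpos : 0 < ε := div_pos (by linarith) (fpos x hx)
    have hV2 : VolEq α c (fun t => w t + ε * f t) (fun t => h' t - f s + ε) := by
      intro y hy
      have e1 := hV y hy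
      have e2 := h y hy
      have e3 : ∫ r in (0:ℝ)..y, (y - r) ^ (α - 1) * (w r + ε * f r) =
          (∫ r in (0:ℝ)..y, (y - r) ^ (α - 1) * w r) +
            ε * ∫ r in (0:ℝ)..y, (y - r) ^ (α - 1) * f r := by
        rw [← intervalIntegral.integral_const_mul, ← intervalIntegral.integral_add
          (kernel_int hα hw _ _ _) ((kernel_int hα hf _ _ _).const_mul _)]
        congr 1; ext r; ring
      simp only at e1 e2 ⊢
      rw [e3]
      conv_lhs => rw [e1, e2]
      ring
    have := vol_pos hα hα1 hc.le (by fun_prop) hV2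
      (fun x hx y hy hxy => add_le_add_left (hM' hx hy hxy) _) (by simp [h'0, hεpos]) x hx
    have hz : w x + ε * f x = 0 := by
      rw [hε, div_mul_cancel₀ _ (fpos x hx).ne']; ring
    linarith
  -- strictness
  have hstrict : 0 < h' t - f s := by
    have hlt : ∫ r in (0:ℝ)..s, (s + t - r) ^ (α - 1) * f r <
        ∫ r in (0:ℝ)..s, (s - r) ^ (α - 1) * f r := by
      rw [← sub_pos, ← intervalIntegral.integral_sub (kernel_int hα hf _ _ _)
        (kernel_int hα hf _ _ _)]
      apply intervalIntegral.intervalIntegral_pos_of_pos_on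
        ((kernel_int hα hf _ _ _).sub (kernel_int hα hf _ _ _)) _ hs
      intro r hr
      rw [← sub_mul]
      apply mul_pos _ (fpos r hr.1.le)
      rw [sub_pos]
      exact Real.rpow_lt_rpow_of_neg (by linarith [hr.2]) (by linarith) (by linarith)
    have e := h s hs.le
    simp only [hh']
    have := mul_lt_mul_of_pos_left hlt hc
    linarith
  have wpos : 0 < w t := by
    by_contra! hle
    have hwt : w t = 0 := le_antisymm hle (wnn t ht.le)
    have hall : ∀ x ∈ Icc 0 t, w x = 0 := by
      intro x hx
      by_contra hne
      have hxp : 0 < w x := lt_of_le_of_ne (wnn x hx.1) (Ne.symm hne)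
      have hv := vol_restart hα hw hV hx.1
      have hm := restart_mono hα hα1 hc.le hw hx.1 hM' (fun t ht => wnn t ht.1)
      have := vol_pos hα hα1 hc.le (by fun_prop) hv hm
        (by rw [add_zero, ← hV _ hx.1]; exact hxp) (t - x) (by linarith [hx.2])
      simp only [add_sub_cancel] at this
      linarith
    have e := hV t ht.le
    have e0 : ∫ r in (0:ℝ)..t, (t - r) ^ (α - 1) * w r = ∫ r in (0:ℝ)..t, (0:ℝ) := by
      apply intervalIntegral.integral_congr
      intro r hr
      rw [uIcc_of_le ht.le] at hr
      simp [hall r hr]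
    rw [e0, hwt] at e
    simp at e
    linarith
  have : 0 < f (s + t) - f s * f t := wpos
  rw [add_comm t s, mul_comm]
  linarith

lemma ml_summable {α : ℝ} (hα : 0 < α) (hα1 : α < 1) (x : ℝ) :
    Summable (fun k : ℕ => x ^ k / Real.Gamma (α * k + 1)) := by
  have hratio : ∀ y : ℝ, 1 ≤ y →
      Real.Gamma y ≤ 2 * (y + α) ^ (-α) * Real.Gamma (y + α) := by
    intro y hy
    have hya : 0 < y + α := by linarith
    have hG := Real.Gamma_pos_of_pos hya
    have h1 := Real.Gamma_mul_add_mul_le_rpow_Gamma_mul_rpow_Gamma (s := y + α) (t := y + α + 1)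
      (a := α) (b := 1 - α) hya (by linarith) hα (by linarith) (by ring)
    have e : α * (y + α) + (1 - α) * (y + α + 1) = y + 1 := by ring
    rw [e, Real.Gamma_add_one (by linarith), Real.Gamma_add_one hya.ne',
      Real.mul_rpow hya.le hG.le, mul_left_comm, ← Real.rpow_add hG] at h1
    rw [show α + (1 - α) = 1 by ring, Real.rpow_one, sub_eq_add_neg, Real.rpow_add hya,
      Real.rpow_one] at h1
    have hp : 0 < (y + α) ^ (-α) * Real.Gamma (y + α) :=
      mul_pos (Real.rpow_pos_of_pos hya _) hG
    have h2 : y * Real.Gamma y ≤ y * (2 * (y + α) ^ (-α) * Real.Gamma (y + α)) := by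
      nlinarith
    exact le_of_mul_le_mul_left h2 (by linarith)
  have hlim : Tendsto (fun k : ℕ => |x| * (2 * (α * k + 1 + α) ^ (-α))) atTop (𝓝 0) := by
    have h1 : Tendsto (fun k : ℕ => α * (k:ℝ) + 1 + α) atTop atTop :=
      tendsto_atTop_add_const_right _ _ (tendsto_atTop_add_const_right _ _
        (tendsto_natCast_atTop_atTop.const_mul_atTop hα))
    have h2 := ((tendsto_rpow_neg_atTop hα).comp h1).const_mul 2 |>.const_mul |x|
    simpa using h2
  apply summable_of_ratio_norm_eventually_le (r := 1/2) (by norm_num)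
  filter_upwards [hlim.eventually_lt_const (show (0:ℝ) < 1/2 by norm_num)] with k hk
  have hy : (1:ℝ) ≤ α * k + 1 := by
    have : 0 ≤ α * k := by positivity
    linarith
  have hr := hratio _ hy
  have g1 : 0 < Real.Gamma (α * k + 1) := Real.Gamma_pos_of_pos (by linarith)
  have g2 : 0 < Real.Gamma (α * k + 1 + α) := Real.Gamma_pos_of_pos (by linarith)
  have e : α * ((k + 1 : ℕ) : ℝ) + 1 = α * k + 1 + α := by push_cast; ring
  rw [e, norm_div, norm_div, norm_pow, norm_pow, Real.norm_of_nonneg g1.le,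
    Real.norm_of_nonneg g2.le, Real.norm_eq_abs, ← mul_div_assoc, div_le_div_iff₀ g2 g1, pow_succ]
  have h3 : |x| * Real.Gamma (α * k + 1) ≤ 1/2 * Real.Gamma (α * k + 1 + α) := by
    calc |x| * Real.Gamma (α * k + 1)
        ≤ |x| * (2 * (α * k + 1 + α) ^ (-α) * Real.Gamma (α * k + 1 + α)) :=
          mul_le_mul_of_nonneg_left hr (abs_nonneg x)
      _ = (|x| * (2 * (α * k + 1 + α) ^ (-α))) * Real.Gamma (α * k + 1 + α) := by ring
      _ ≤ _ := mul_le_mul_of_nonneg_right hk.le g2.le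
  have := mul_le_mul_of_nonneg_left h3 (pow_nonneg (abs_nonneg x) k)
  nlinarith

lemma ml_continuous {α : ℝ} (hα : 0 < α) (hα1 : α < 1) : Continuous (ML α) := by
  rw [continuous_iff_continuousAt]
  intro x
  have h : ContinuousOn (ML α) (Metric.closedBall 0 (|x| + 1)) := by
    unfold ML mittagLeffler
    apply continuousOn_tsum (u := fun k : ℕ => (|x| + 1) ^ k / Real.Gamma (α * k + 1))
      (fun k => by fun_prop) (ml_summable hα hα1 _)
    intro k y hy
    have g1 : 0 < Real.Gamma (α * k + 1) := Real.Gamma_pos_of_pos (by positivity)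
    rw [norm_div, norm_pow, Real.norm_of_nonneg g1.le]
    gcongr
    simpa using hy
  exact h.continuousAt (Metric.closedBall_mem_nhds_of_mem (by simp))

lemma beta_real {α b t : ℝ} (hα : 0 < α) (hb : 0 < b) (ht : 0 < t) :
    ∫ r in (0:ℝ)..t, (t - r) ^ (α - 1) * r ^ (b - 1) =
      t ^ (b + α - 1) * (Real.Gamma b * Real.Gamma α / Real.Gamma (b + α)) := by
  have h := Complex.betaIntegral_scaled (b : ℂ) (α : ℂ) ht
  rw [Complex.betaIntegral_eq_Gamma_mul_div _ _ (by simpa) (by simpa)] at h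
  have e : ∫ r in (0:ℝ)..t, ((r:ℂ) ^ ((b:ℂ) - 1) * ((t:ℂ) - r) ^ ((α:ℂ) - 1)) =
      ∫ r in (0:ℝ)..t, (((t - r) ^ (α - 1) * r ^ (b - 1) : ℝ) : ℂ) := by
    apply intervalIntegral.integral_congr
    intro r hr
    rw [uIcc_of_le ht.le] at hr
    simp only
    rw [Complex.ofReal_mul, Complex.ofReal_cpow (by linarith [hr.2]),
      Complex.ofReal_cpow hr.1]
    push_cast
    ring
  rw [e, intervalIntegral.integral_ofReal] at h
  rw [← Complex.ofReal_add, Complex.Gamma_ofReal, Complex.Gamma_ofReal, Complex.Gamma_ofReal,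
    ← Complex.ofReal_one, ← Complex.ofReal_sub, ← Complex.ofReal_cpow ht.le] at h
  exact_mod_cast h

lemma ml_vol {α lam : ℝ} (hα : 0 < α) (hα1 : α < 1) (hlam : 0 < lam) :
    VolEq α (lam / Real.Gamma α) (fun t => ML α (-(lam * t ^ α))) (fun _ => 1) := by
  intro t ht
  simp only
  have hML0 : ML α 0 = 1 := by
    unfold ML mittagLeffler
    rw [tsum_eq_single 0 (by intro k hk; simp [hk])]
    simp
  rcases ht.eq_or_lt with rfl | ht
  · simp [Real.zero_rpow hα.ne', hML0]
  have hGα := Real.Gamma_pos_of_pos hα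
  have hsum : HasSum (fun k : ℕ => ∫ r in (0:ℝ)..t, (t - r) ^ (α - 1) *
      ((-(lam * r ^ α)) ^ k / Real.Gamma (α * k + 1)))
      (∫ r in (0:ℝ)..t, (t - r) ^ (α - 1) * ML α (-(lam * r ^ α))) := by
    apply intervalIntegral.hasSum_integral_of_dominated_convergence
      (fun (k : ℕ) (r : ℝ) => (t - r) ^ (α - 1) * ((lam * t ^ α) ^ k / Real.Gamma (α * k + 1)))
    · intro k
      have hc : Continuous (fun r : ℝ => (-(lam * r ^ α)) ^ k / Real.Gamma (α * k + 1)) := by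
        have : Continuous (fun r : ℝ => r ^ α) :=
          continuous_id.rpow_const (fun _ => Or.inr hα.le)
        fun_prop
      exact (kernel_int hα hc t 0 t).def'.aestronglyMeasurable
    · intro k
      refine Eventually.of_forall (fun r hr => ?_)
      rw [uIoc_of_le ht.le] at hr
      have g1 : 0 < Real.Gamma (α * k + 1) := Real.Gamma_pos_of_pos (by positivity)
      have hr0 := hr.1.le
      have hr1 : 0 ≤ (t - r) ^ (α - 1) := Real.rpow_nonneg (by linarith [hr.2]) _
      rw [norm_mul, norm_div, norm_pow, norm_neg, Real.norm_of_nonneg g1.le,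
        Real.norm_of_nonneg hr1, Real.norm_of_nonneg (by positivity)]
      have := hr.2
      gcongr
    · exact Eventually.of_forall (fun r hr => (ml_summable hα hα1 _).mul_left _)
    · simp only [tsum_mul_left]
      exact kernel_int hα continuous_const _ _ _
    · exact Eventually.of_forall (fun r hr => (ml_summable hα hα1 _).hasSum.mul_left _)
  have hterm : ∀ k : ℕ, ∫ r in (0:ℝ)..t, (t - r) ^ (α - 1) *
      ((-(lam * r ^ α)) ^ k / Real.Gamma (α * k + 1)) =
      -(Real.Gamma α / lam) * ((-(lam * t ^ α)) ^ (k + 1) / Real.Gamma (α * (k + 1 : ℕ) + 1)) := by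
    intro k
    have g1 : 0 < Real.Gamma (α * k + 1) := Real.Gamma_pos_of_pos (by positivity)
    have g2 : 0 < Real.Gamma (α * k + 1 + α) := Real.Gamma_pos_of_pos (by positivity)
    have hb := beta_real (b := α * k + 1) hα (by positivity) ht
    have e1 : ∫ r in (0:ℝ)..t, (t - r) ^ (α - 1) *
      ((-(lam * r ^ α)) ^ k / Real.Gamma (α * k + 1)) =
      ∫ r in (0:ℝ)..t, ((-lam) ^ k / Real.Gamma (α * k + 1)) *
        ((t - r) ^ (α - 1) * r ^ (α * k + 1 - 1)) := by
      apply intervalIntegral.integral_congr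
      intro r hr
      rw [uIcc_of_le ht.le] at hr
      simp only
      rw [add_sub_cancel_right, Real.rpow_mul hr.1, Real.rpow_natCast, ← neg_mul, mul_pow]
      ring
    rw [e1, intervalIntegral.integral_const_mul, hb]
    have e2 : α * ((k + 1 : ℕ) : ℝ) + 1 = α * k + 1 + α := by push_cast; ring
    have e3 : t ^ (α * k + 1 + α - 1) = (t ^ α) ^ (k + 1) := by
      rw [← Real.rpow_natCast, ← Real.rpow_mul ht.le]
      congr 1; push_cast; ring
    rw [e2, e3, ← neg_mul, mul_pow, pow_succ (-lam)]
    field_simp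
  have hI := hsum.tsum_eq
  simp_rw [hterm] at hI
  rw [tsum_mul_left] at hI
  rw [← hI]
  have hs := (ml_summable hα hα1 (-(lam * t ^ α))).tsum_eq_zero_add
  unfold ML mittagLeffler
  rw [hs]
  simp
  field_simp

/-- Sub-additive property of the Mittag-Leffler function along powers. -/
theorem mittagLeffler_subadd (α lam t s : ℝ) (hα : α ∈ Set.Ioo (0:ℝ) 1)
    (hlam : 0 < lam) (ht : 0 ≤ t) (hs : 0 ≤ s) :
    ML α (-(lam * t ^ α)) * ML α (-(lam * s ^ α)) ≤ ML α (-(lam * (t + s) ^ α)) ∧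
    (0 < t * s →
      ML α (-(lam * t ^ α)) * ML α (-(lam * s ^ α)) < ML α (-(lam * (t + s) ^ α))) := by
  obtain ⟨h0, h1⟩ := hα
  have hv := ml_vol h0 h1 hlam
  have hcont : Continuous (fun t : ℝ => ML α (-(lam * t ^ α))) := by
    have : Continuous (fun r : ℝ => r ^ α) := continuous_id.rpow_const (fun _ => Or.inr h0.le)
    exact (ml_continuous h0 h1).comp (by fun_prop)
  have key : 0 < t → 0 < s →
      ML α (-(lam * t ^ α)) * ML α (-(lam * s ^ α)) < ML α (-(lam * (t + s) ^ α)) :=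
    fun ht hs => vol_subadd h0 h1 (div_pos hlam (Real.Gamma_pos_of_pos h0)) hcont hv ht hs
  have hML0 : ML α (-(lam * 0 ^ α)) = 1 := by simpa using hv 0 le_rfl
  constructor
  · rcases ht.eq_or_lt with rfl | ht
    · rw [hML0, zero_add, one_mul]
    rcases hs.eq_or_lt with rfl | hs
    · rw [hML0, add_zero, mul_one]
    exact (key ht hs).le
  · intro hts
    refine key (lt_of_le_of_ne ht ?_) (lt_of_le_of_ne hs ?_)
    · rintro rfl; simp at hts
    · rintro rfl; simp at hts
end

section
/- Let α ∈ (0,1], T > 0, and let x : [0,T] → ℝ be continuous such that the Caputo fractional derivative D^α_{0+} x(t) exists on (0,T]. If there exists t₁ ∈ (0,T] with x(t₁) = 0 and x(t) < 0 for all t ∈ [0, t₁), then D^α_{0+} x(t₁) ≥ 0. -/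
open Real MeasureTheory Set

lemma inner_int (α η v : ℝ) (h0 : 0 < α) (h1 : α < 1) (hη : 0 < η) (hv : η ≤ v) :
    ∫ u in η..v, u ^ (α - 2) * (v - u) ^ (-α) = v⁻¹ * (v / η - 1) ^ (1 - α) / (1 - α) := by
  have hv0 : 0 < v := lt_of_lt_of_le hη hv
  have hcont : ContinuousOn (fun u : ℝ => -(v⁻¹ * (v / u - 1) ^ (1 - α) / (1 - α))) (Icc η v) := by
    refine ContinuousOn.neg (ContinuousOn.div_const (ContinuousOn.mul continuousOn_const ?_) _)
    refine ContinuousOn.rpow_const ?_ (fun x _ => Or.inr (by linarith))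
    refine ContinuousOn.sub (ContinuousOn.div continuousOn_const continuousOn_id ?_) continuousOn_const
    intro x hx
    exact (lt_of_lt_of_le hη hx.1).ne'
  have hderiv : ∀ u ∈ Ioo η v, HasDerivAt (fun u : ℝ => -(v⁻¹ * (v / u - 1) ^ (1 - α) / (1 - α)))
      (u ^ (α - 2) * (v - u) ^ (-α)) u := by
    intro u hu
    have hu0 : 0 < u := hη.trans hu.1
    have hz : 0 < v / u - 1 := by
      rw [sub_pos, lt_div_iff₀ hu0]; linarith [hu.2]
    have e1 : HasDerivAt (fun u : ℝ => v / u - 1) (-v / u ^ 2) u := by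
      have := ((hasDerivAt_inv hu0.ne').const_mul v).sub_const 1
      refine (this.congr_deriv ?_)
      ring
    have e2 := e1.rpow_const (p := 1 - α) (Or.inl hz.ne')
    have e3 := ((e2.const_mul v⁻¹).div_const (1 - α)).neg
    refine HasDerivAt.congr_deriv e3 ?_
    have : v / u - 1 = (v - u) / u := by field_simp
    rw [this, show 1 - α - 1 = -α by ring, div_rpow (by linarith [hu.2]) hu0.le,
      show α - 2 = -(2:ℕ) - -α by push_cast; ring, rpow_sub hu0, rpow_neg hu0.le ((2:ℕ):ℝ), rpow_natCast]
    have : 1 - α ≠ 0 := by linarith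
    have : u ^ (-α) ≠ 0 := (rpow_pos_of_pos hu0 _).ne'
    field_simp
  have hint := intervalIntegral.integrableOn_deriv_of_nonneg hcont hderiv (fun u hu =>
    mul_nonneg (rpow_nonneg (hη.trans hu.1).le _) (rpow_nonneg (by linarith [hu.2]) _))
  rw [intervalIntegral.integral_eq_sub_of_hasDerivAt_of_le hv hcont hderiv
    ((intervalIntegrable_iff_integrableOn_Ioc_of_le hv).2 hint)]
  rw [div_self hv0.ne', sub_self, zero_rpow (by linarith)]
  ring

lemma swap_int (α η ε : ℝ) (h1 : α < 1) (hη : 0 < η) (hε : η ≤ ε)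
    (W : ℝ → ℝ) (hW : Continuous W) :
    IntervalIntegrable (fun u => u ^ (α - 2) * ∫ v in u..ε, (v - u) ^ (-α) * W v) volume η ε ∧
    IntervalIntegrable (fun v => W v * ∫ u in η..v, u ^ (α - 2) * (v - u) ^ (-α)) volume η ε ∧
    ∫ u in η..ε, u ^ (α - 2) * ∫ v in u..ε, (v - u) ^ (-α) * W v =
      ∫ v in η..ε, W v * ∫ u in η..v, u ^ (α - 2) * (v - u) ^ (-α) := by
  set κ : ℝ → ℝ := indicator (Ioc 0 ε) (fun s => s ^ (-α)) with hκ
  set f : ℝ → ℝ := indicator (Ioc η ε) (fun u => u ^ (α - 2)) with hf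
  set ψ : ℝ → ℝ := indicator (Ioc η ε) W with hψ
  have hε0 : 0 < ε := lt_of_lt_of_le hη hε
  have iκ : Integrable κ := by
    rw [hκ, integrable_indicator_iff measurableSet_Ioc]
    exact (intervalIntegrable_iff_integrableOn_Ioc_of_le hε0.le).1
      (intervalIntegral.intervalIntegrable_rpow' (by linarith))
  have jf : Integrable f := by
    rw [hf, integrable_indicator_iff measurableSet_Ioc]
    refine IntegrableOn.mono_set (ContinuousOn.integrableOn_Icc ?_) Ioc_subset_Icc_self
    refine ContinuousOn.rpow_const continuousOn_id (fun x hx => Or.inl ?_)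
    exact (lt_of_lt_of_le hη hx.1).ne'
  have h := Integrable.convolution_integrand (ContinuousLinearMap.mul ℝ ℝ) jf iκ
  obtain ⟨M, hM⟩ : ∃ M, ∀ v ∈ Icc η ε, ‖W v‖ ≤ M :=
    isCompact_Icc.exists_bound_of_continuousOn hW.continuousOn
  have hM0 : 0 ≤ M := (norm_nonneg _).trans (hM η ⟨le_rfl, hε⟩)
  have mψ : Measurable ψ := hW.measurable.indicator measurableSet_Ioc
  have hF : Integrable (fun p : ℝ × ℝ => ψ p.1 * (f p.2 * κ (p.1 - p.2)))
      ((volume : Measure ℝ).prod volume) := by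
    refine Integrable.bdd_mul (c := M) h (mψ.comp measurable_fst).aestronglyMeasurable ?_
    refine Filter.Eventually.of_forall (fun p => ?_)
    by_cases hp : p.1 ∈ Ioc η ε
    · simp only [hψ, indicator_of_mem hp]; exact hM _ (Ioc_subset_Icc_self hp)
    · simp only [hψ, indicator_of_notMem hp, norm_zero]; exact hM0
  have A : (fun v => ∫ u, ψ v * (f u * κ (v - u))) =
      indicator (Ioc η ε) (fun v => W v * ∫ u in η..v, u ^ (α - 2) * (v - u) ^ (-α)) := by
    funext v
    by_cases hv : v ∈ Ioc η ε
    · rw [indicator_of_mem hv, integral_const_mul, hψ, indicator_of_mem hv,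
        intervalIntegral.integral_of_le hv.1.le, integral_Ioc_eq_integral_Ioo,
        ← integral_indicator measurableSet_Ioo]
      congr 2
      funext u
      by_cases hu : u ∈ Ioo η v
      · rw [indicator_of_mem hu, hf, hκ, indicator_of_mem, indicator_of_mem]
        · exact ⟨by linarith [hu.2], by linarith [hu.1, hv.2]⟩
        · exact ⟨hu.1, hu.2.le.trans hv.2⟩
      · rw [indicator_of_notMem hu]
        by_cases h2 : η < u
        · have : v - u ∉ Ioc 0 ε := fun h3 => hu ⟨h2, by linarith [h3.1]⟩
          rw [hκ, indicator_of_notMem this, mul_zero]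
        · rw [hf, indicator_of_notMem (fun h3 => h2 h3.1), zero_mul]
    · simp [indicator_of_notMem hv, hψ]
  have B : (fun u => ∫ v, ψ v * (f u * κ (v - u))) =
      indicator (Ioc η ε) (fun u => u ^ (α - 2) * ∫ v in u..ε, (v - u) ^ (-α) * W v) := by
    funext u
    by_cases hu : u ∈ Ioc η ε
    · rw [indicator_of_mem hu, intervalIntegral.integral_of_le hu.2,
        ← integral_indicator measurableSet_Ioc, ← integral_const_mul]
      congr 1
      funext v
      by_cases hv : v ∈ Ioc u ε
      · rw [indicator_of_mem hv, hψ, hf, hκ, indicator_of_mem, indicator_of_mem hu,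
          indicator_of_mem]
        · ring
        · exact ⟨by linarith [hv.1], by linarith [hv.2, hu.1]⟩
        · exact ⟨hu.1.trans hv.1, hv.2⟩
      · rw [indicator_of_notMem hv]
        by_cases h2 : v ≤ ε
        · have : v - u ∉ Ioc 0 ε := fun h3 => hv ⟨by linarith [h3.1], h2⟩
          rw [hκ, indicator_of_notMem this]; ring
        · rw [hψ, indicator_of_notMem (fun h3 => h2 h3.2)]; ring
    · simp [indicator_of_notMem hu, hf]
  refine ⟨?_, ?_, ?_⟩
  · have := hF.integral_prod_right
    simp only at this
    rw [B, integrable_indicator_iff measurableSet_Ioc] at this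
    exact (intervalIntegrable_iff_integrableOn_Ioc_of_le hε).2 this
  · have := hF.integral_prod_left
    simp only at this
    rw [A, integrable_indicator_iff measurableSet_Ioc] at this
    exact (intervalIntegrable_iff_integrableOn_Ioc_of_le hε).2 this
  · have := integral_integral_swap (f := fun v u => ψ v * (f u * κ (v - u))) hF
    rw [A, B, integral_indicator measurableSet_Ioc, integral_indicator measurableSet_Ioc] at this
    rw [intervalIntegral.integral_of_le hε, intervalIntegral.integral_of_le hε, this]

lemma sing_int (α u a b : ℝ) (h1 : α < 1) (W : ℝ → ℝ) (hW : Continuous W) :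
    IntervalIntegrable (fun v => (v - u) ^ (-α) * W v) volume a b := by
  have h : IntervalIntegrable (fun v : ℝ => v ^ (-α)) volume (a - u) (b - u) :=
    intervalIntegral.intervalIntegrable_rpow' (by linarith)
  have h2 := h.comp_sub_right u
  simp only [sub_add_cancel] at h2
  exact h2.mul_continuousOn hW.continuousOn

lemma sing_int0 (α a b : ℝ) (h1 : α < 1) (W : ℝ → ℝ) (hW : Continuous W) :
    IntervalIntegrable (fun v => v ^ (-α) * W v) volume a b := by
  simpa using sing_int α 0 a b h1 W hW

lemma key_ineq (α ε d η : ℝ) (h0 : 0 < α) (h1 : α < 1) (hη : 0 < η) (hε : η < ε)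
    (W : ℝ → ℝ) (hW : Continuous W) (hpos : ∀ v ∈ Icc 0 ε, 0 ≤ W v)
    (h : ∀ u ∈ Ioo 0 ε, d * u ≤ (∫ v in 0..ε, v ^ (-α) * W v) - ∫ v in u..ε, (v - u) ^ (-α) * W v) :
    (1 - α) * d * (ε ^ α - η ^ α) / α ≤ (∫ v in 0..ε, v ^ (-α) * W v) * η ^ (α - 1)
      - ∫ v in η..ε, W v * (v⁻¹ * (v / η - 1) ^ (1 - α)) := by
  obtain ⟨i1, i2, e⟩ := swap_int α η ε h1 hη hε.le W hW
  have hε0 := hη.trans hε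
  set P := ∫ v in 0..ε, v ^ (-α) * W v with hP
  have hP0 : 0 ≤ P := intervalIntegral.integral_nonneg hε0.le
    (fun v hv => mul_nonneg (rpow_nonneg hv.1 _) (hpos v hv))
  have h0n : (0:ℝ) ∉ uIcc η ε := by
    rw [uIcc_of_le hε.le]; intro h; linarith [h.1]
  have j1 : IntervalIntegrable (fun u : ℝ => u ^ (α - 2)) volume η ε :=
    intervalIntegral.intervalIntegrable_rpow (Or.inr h0n)
  have j2 : IntervalIntegrable (fun u : ℝ => u ^ (α - 1)) volume η ε :=
    intervalIntegral.intervalIntegrable_rpow (Or.inr h0n)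
  have m : ∫ u in η..ε, d * u ^ (α - 1) ≤
      ∫ u in η..ε, (P * u ^ (α - 2) - u ^ (α - 2) * ∫ v in u..ε, (v - u) ^ (-α) * W v) := by
    refine intervalIntegral.integral_mono_on_of_le_Ioo hε.le (j2.const_mul d)
      ((j1.const_mul P).sub i1) ?_
    intro u hu
    have hu0 : 0 < u := hη.trans hu.1
    have := mul_le_mul_of_nonneg_left (h u ⟨hu0, hu.2⟩) (rpow_nonneg hu0.le (α - 2))
    have e1 : u ^ (α - 1) = u ^ (α - 2) * u := by
      rw [show α - 1 = (α - 2) + 1 by ring, rpow_add_one hu0.ne']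
    rw [e1]
    linarith
  rw [intervalIntegral.integral_sub (j1.const_mul P) i1, e, intervalIntegral.integral_const_mul,
    intervalIntegral.integral_const_mul, integral_rpow (r := α - 2) (Or.inr ⟨by linarith, h0n⟩),
    integral_rpow (r := α - 1) (Or.inl (by linarith))] at m
  have e2 : ∫ v in η..ε, W v * ∫ u in η..v, u ^ (α - 2) * (v - u) ^ (-α) =
      (∫ v in η..ε, W v * (v⁻¹ * (v / η - 1) ^ (1 - α))) * (1 - α)⁻¹ := by
    rw [← intervalIntegral.integral_mul_const]
    refine intervalIntegral.integral_congr (fun v hv => ?_)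
    rw [uIcc_of_le hε.le] at hv
    rw [inner_int α η v h0 h1 hη hv.1]
    ring
  rw [e2] at m
  rw [show α - 1 + 1 = α by ring, show α - 2 + 1 = α - 1 by ring] at m
  have h1' : 0 < 1 - α := by linarith
  have m2 := mul_le_mul_of_nonneg_left m h1'.le
  have e3 : (1 - α) * (P * ((ε ^ (α - 1) - η ^ (α - 1)) / (α - 1)) -
      (∫ v in η..ε, W v * (v⁻¹ * (v / η - 1) ^ (1 - α))) * (1 - α)⁻¹) =
      P * η ^ (α - 1) - P * ε ^ (α - 1) - ∫ v in η..ε, W v * (v⁻¹ * (v / η - 1) ^ (1 - α)) := by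
    have : α - 1 ≠ 0 := by linarith
    have h3 : (1 - α) ≠ 0 := by linarith
    have e4 : (ε ^ (α - 1) - η ^ (α - 1)) / (α - 1) = (η ^ (α - 1) - ε ^ (α - 1)) * (1 - α)⁻¹ := by
      rw [← div_eq_mul_inv, div_eq_div_iff this h3]; ring
    rw [e4]
    field_simp
  rw [e3] at m2
  have : 0 ≤ P * ε ^ (α - 1) := mul_nonneg hP0 (rpow_nonneg hε0.le _)
  have e5 : (1 - α) * d * (ε ^ α - η ^ α) / α = (1 - α) * (d * ((ε ^ α - η ^ α) / α)) := by ring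
  rw [e5]
  linarith

lemma ptw (α η v : ℝ) (h0 : 0 < α) (h1 : α < 1) (hη : 0 < η) (hv : η ≤ v) :
    v ^ (-α) * η ^ (α - 1) - v⁻¹ * (v / η - 1) ^ (1 - α) ≤ v ^ (-1 - α) * η ^ α := by
  have hv0 : 0 < v := lt_of_lt_of_le hη hv
  have hy : 1 ≤ v / η := by rwa [one_le_div hη]
  have hy0 : 0 < v / η := by positivity
  have k : (v / η - 1) * (v / η) ^ (-α) ≤ (v / η - 1) ^ (1 - α) := by
    rcases hy.eq_or_lt with h | h
    · rw [← h, sub_self, zero_mul]; exact rpow_nonneg le_rfl _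
    · have hz : 0 < v / η - 1 := by linarith
      rw [show 1 - α = 1 + -α by ring, rpow_add hz, rpow_one]
      exact mul_le_mul_of_nonneg_left
        (rpow_le_rpow_of_nonpos hz (by linarith) (by linarith)) hz.le
  have k2 := mul_le_mul_of_nonneg_left k (inv_pos.2 hv0).le
  have e1 : (v / η) ^ (-α) = v ^ (-α) * η ^ α := by
    rw [div_rpow hv0.le hη.le, rpow_neg hη.le, div_inv_eq_mul]
  have e2 : η ^ (α - 1) = η ^ α / η := rpow_sub_one hη.ne' _
  have e3 : v ^ (-1 - α) = v⁻¹ * v ^ (-α) := by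
    rw [show -1 - α = -α - 1 by ring, rpow_sub_one hv0.ne']; ring
  rw [e1] at k2
  rw [e2, e3]
  have e4 : v⁻¹ * ((v / η - 1) * (v ^ (-α) * η ^ α)) =
      v ^ (-α) * (η ^ α / η) - v⁻¹ * v ^ (-α) * η ^ α := by
    field_simp
  linarith

lemma upper (α ε η τ C : ℝ) (h0 : 0 < α) (h1 : α < 1) (hη : 0 < η) (hε : η < ε)
    (hτ : 0 ≤ τ) (hC : 0 ≤ C)
    (W : ℝ → ℝ) (hW : Continuous W) (hpos : ∀ v ∈ Icc 0 ε, 0 ≤ W v)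
    (hup : ∀ v ∈ Icc 0 ε, W v ≤ τ + C * v) :
    (∫ v in 0..ε, v ^ (-α) * W v) * η ^ (α - 1)
      - ∫ v in η..ε, W v * (v⁻¹ * (v / η - 1) ^ (1 - α)) ≤
    (τ + C * η) / (1 - α) + (τ / α + C * η ^ α * (ε ^ (1 - α) / (1 - α))) := by
  have hε0 := hη.trans hε
  have h1' : 0 < 1 - α := by linarith
  have h0n : (0:ℝ) ∉ uIcc η ε := by
    rw [uIcc_of_le hε.le]; intro h; linarith [h.1]
  have s := intervalIntegral.integral_add_adjacent_intervals (sing_int0 α 0 η h1 W hW)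
    (sing_int0 α η ε h1 W hW)
  rw [← s, add_mul, add_sub_assoc]
  refine add_le_add ?_ ?_
  · have : ∫ v in 0..η, v ^ (-α) * W v ≤ ∫ v in 0..η, v ^ (-α) * (τ + C * η) := by
      refine intervalIntegral.integral_mono_on hη.le (sing_int0 α 0 η h1 W hW)
        (sing_int0 α 0 η h1 (fun _ => τ + C * η) continuous_const) ?_
      intro v hv
      refine mul_le_mul_of_nonneg_left ?_ (rpow_nonneg hv.1 _)
      have := hup v ⟨hv.1, hv.2.trans hε.le⟩
      have := mul_le_mul_of_nonneg_left hv.2 hC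
      linarith
    rw [intervalIntegral.integral_mul_const, integral_rpow (Or.inl (by linarith)),
      show -α + 1 = 1 - α by ring, zero_rpow h1'.ne', sub_zero] at this
    have := mul_le_mul_of_nonneg_right this (rpow_nonneg hη.le (α - 1))
    refine this.trans (le_of_eq ?_)
    have e : η ^ (1 - α) * η ^ (α - 1) = 1 := by
      rw [← rpow_add hη]; simp
    calc η ^ (1 - α) / (1 - α) * (τ + C * η) * η ^ (α - 1)
        = (η ^ (1 - α) * η ^ (α - 1)) * ((τ + C * η) / (1 - α)) := by ring
      _ = _ := by rw [e, one_mul]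
  · have ic : IntervalIntegrable (fun v => W v * (v⁻¹ * (v / η - 1) ^ (1 - α))) volume η ε := by
      refine ContinuousOn.intervalIntegrable ?_
      refine hW.continuousOn.mul (ContinuousOn.mul ?_ ?_)
      · exact continuousOn_id.inv₀ (fun x hx hx0 => h0n (by simpa [← hx0] using hx))
      · refine ContinuousOn.rpow_const (by fun_prop) (fun x _ => Or.inr h1'.le)
    rw [← intervalIntegral.integral_mul_const,
      ← intervalIntegral.integral_sub ((sing_int0 α η ε h1 W hW).mul_const _) ic]
    have j1 : IntervalIntegrable (fun v : ℝ => v ^ (-1 - α)) volume η ε :=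
      intervalIntegral.intervalIntegrable_rpow (Or.inr h0n)
    have j2 : IntervalIntegrable (fun v : ℝ => v ^ (-α)) volume η ε :=
      intervalIntegral.intervalIntegrable_rpow (Or.inr h0n)
    have m : ∫ v in η..ε, (v ^ (-α) * W v * η ^ (α - 1) - W v * (v⁻¹ * (v / η - 1) ^ (1 - α))) ≤
        ∫ v in η..ε, (τ * η ^ α * v ^ (-1 - α) + C * η ^ α * v ^ (-α)) := by
      refine intervalIntegral.integral_mono_on hε.le
        (((sing_int0 α η ε h1 W hW).mul_const _).sub ic)
        ((j1.const_mul _).add (j2.const_mul _)) ?_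
      intro v hv
      have hv0 : 0 < v := lt_of_lt_of_le hη hv.1
      have a1 := mul_le_mul_of_nonneg_left (ptw α η v h0 h1 hη hv.1) (hpos v ⟨hv0.le, hv.2⟩)
      have a2 := mul_le_mul_of_nonneg_right (hup v ⟨hv0.le, hv.2⟩)
        (mul_nonneg (rpow_nonneg hv0.le (-1 - α)) (rpow_nonneg hη.le α))
      have e3 : v ^ (-α) = v * v ^ (-1 - α) := by
        rw [show -1 - α = -α - 1 by ring, rpow_sub_one hv0.ne']; field_simp
      have e4 : (τ + C * v) * (v ^ (-1 - α) * η ^ α) =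
        τ * η ^ α * v ^ (-1 - α) + C * η ^ α * v ^ (-α) := by rw [e3]; ring
      linarith
    refine m.trans ?_
    rw [intervalIntegral.integral_add (j1.const_mul _) (j2.const_mul _),
      intervalIntegral.integral_const_mul, intervalIntegral.integral_const_mul,
      integral_rpow (Or.inr ⟨by linarith, h0n⟩), integral_rpow (Or.inl (by linarith)),
      show -α + 1 = 1 - α by ring, show -1 - α + 1 = -α by ring]
    refine add_le_add ?_ ?_
    · have e : η ^ α * η ^ (-α) = 1 := by rw [← rpow_add hη]; simp
      have e5 : τ * η ^ α * ((ε ^ (-α) - η ^ (-α)) / -α) =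
          τ / α * (η ^ α * η ^ (-α)) - τ / α * (η ^ α * ε ^ (-α)) := by field_simp; ring
      rw [e5, e]
      have : 0 ≤ τ / α * (η ^ α * ε ^ (-α)) := by positivity
      linarith
    · refine mul_le_mul_of_nonneg_left ?_ (by positivity)
      refine div_le_div_of_nonneg_right ?_ h1'.le
      linarith [rpow_nonneg hη.le (1 - α)]

lemma core (α ε d : ℝ) (h0 : 0 < α) (h1 : α < 1) (hε : 0 < ε) (hd : 0 < d)
    (W : ℝ → ℝ) (hW : Continuous W) (hW0 : W 0 = 0) (hpos : ∀ v ∈ Icc 0 ε, 0 ≤ W v)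
    (h : ∀ u ∈ Ioo 0 ε, d * u ≤ (∫ v in 0..ε, v ^ (-α) * W v) - ∫ v in u..ε, (v - u) ^ (-α) * W v) :
    False := by
  have h1' : 0 < 1 - α := by linarith
  set A := (1 - α) * d * ε ^ α / α with hA
  have hA0 : 0 < A := by positivity
  set B := 1 / (1 - α) + 1 / α with hB
  have hB0 : 0 < B := by positivity
  set τ := A / (2 * B) with hτ
  have hτ0 : 0 < τ := by positivity
  obtain ⟨M, hM⟩ : ∃ M, ∀ v ∈ Icc 0 ε, ‖W v‖ ≤ M :=
    isCompact_Icc.exists_bound_of_continuousOn hW.continuousOn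
  have hM0 : 0 ≤ M := (norm_nonneg _).trans (hM 0 ⟨le_rfl, hε.le⟩)
  obtain ⟨δ, hδ, hδ2⟩ := Metric.continuousAt_iff.1 (hW.continuousAt (x := 0)) τ hτ0
  have hup : ∀ v ∈ Icc 0 ε, W v ≤ τ + M / δ * v := by
    intro v hv
    by_cases hvd : v < δ
    · have := hδ2 (x := v) (by simpa [abs_of_nonneg hv.1] using hvd)
      rw [hW0, dist_zero_right] at this
      have h2 : 0 ≤ M / δ * v := mul_nonneg (by positivity) hv.1
      linarith [le_abs_self (W v), (Real.norm_eq_abs (W v))]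
    · push Not at hvd
      have a1 : M ≤ M / δ * v := by
        rw [div_mul_eq_mul_div, le_div_iff₀ hδ]; exact mul_le_mul_of_nonneg_left hvd hM0
      linarith [le_abs_self (W v), (Real.norm_eq_abs (W v)), hM v hv]
  have fin : ∀ η ∈ Ioo 0 ε, (1 - α) * d * (ε ^ α - η ^ α) / α ≤
      (τ + M / δ * η) / (1 - α) + (τ / α + M / δ * η ^ α * (ε ^ (1 - α) / (1 - α))) :=
    fun η hη => (key_ineq α ε d η h0 h1 hη.1 hη.2 W hW hpos h).trans
      (upper α ε η τ (M / δ) h0 h1 hη.1 hη.2 hτ0.le (by positivity) W hW hpos hup)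
  have cp : Continuous (fun η : ℝ => η ^ α) := continuous_rpow_const h0.le
  have c1 : Continuous (fun η : ℝ => (1 - α) * d * (ε ^ α - η ^ α) / α) := by fun_prop
  have c2 : Continuous (fun η : ℝ =>
    (τ + M / δ * η) / (1 - α) + (τ / α + M / δ * η ^ α * (ε ^ (1 - α) / (1 - α)))) := by fun_prop
  have l := le_of_tendsto_of_tendsto (b := nhdsWithin (0:ℝ) (Ioi 0))
    ((c1.tendsto 0).mono_left nhdsWithin_le_nhds) ((c2.tendsto 0).mono_left nhdsWithin_le_nhds)
    (by filter_upwards [Ioo_mem_nhdsGT hε] with η hη using fin η hη)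
  simp only [zero_rpow h0.ne', sub_zero, mul_zero, zero_mul, add_zero] at l
  have e : τ / (1 - α) + τ / α = τ * B := by rw [hB]; ring
  have e2 : τ * B = A / 2 := by rw [hτ]; field_simp
  rw [e, e2] at l
  linarith

lemma reduction (α ε d t : ℝ) (h0 : 0 < α) (h1 : α < 1) (hε : 0 < ε) (hεt : ε < t) (hd : 0 < d)
    (X : ℝ → ℝ) (hX : Continuous X) (hXt : X t = 0) (hneg : ∀ s ∈ Icc 0 t, X s ≤ 0)
    (h : ∀ u ∈ Ioo 0 ε, (∫ r in (0:ℝ)..t, (t - r) ^ (-α) * (X r - X 0)) -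
      (∫ r in (0:ℝ)..(t - u), (t - u - r) ^ (-α) * (X r - X 0)) ≤ - (d * u)) : False := by
  have h1' : 0 < 1 - α := by linarith
  set W : ℝ → ℝ := fun v => - X (t - v) with hWd
  have hW : Continuous W := by fun_prop
  have hWp : ∀ v ∈ Icc 0 t, 0 ≤ W v := fun v hv => by
    have := hneg (t - v) ⟨by linarith [hv.2], by linarith [hv.1]⟩
    simp only [hWd]; linarith
  have hc : 0 ≤ - X 0 := by have := hneg 0 ⟨le_rfl, by linarith⟩; linarith
  have conv : ∀ u, (∫ r in (0:ℝ)..(t - u), (t - u - r) ^ (-α) * (X r - X 0)) =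
      (- X 0) * ((t - u) ^ (1 - α) / (1 - α)) - ∫ v in u..t, (v - u) ^ (-α) * W v := by
    intro u
    have e := intervalIntegral.integral_comp_sub_left (a := u) (b := t)
      (fun r => (t - u - r) ^ (-α) * (X r - X 0)) t
    rw [sub_self] at e
    rw [← e]
    have e2 : (fun v => (t - u - (t - v)) ^ (-α) * (X (t - v) - X 0)) =
        fun v => (v - u) ^ (-α) * (fun _ => - X 0) v - (v - u) ^ (-α) * W v := by
      funext v
      simp only [hWd]
      rw [show t - u - (t - v) = v - u by ring]; ring
    rw [e2, intervalIntegral.integral_sub (sing_int α u u t h1 _ continuous_const)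
      (sing_int α u u t h1 W hW), intervalIntegral.integral_mul_const,
      intervalIntegral.integral_comp_sub_right (fun v => v ^ (-α)) u, sub_self,
      integral_rpow (Or.inl (by linarith)), show -α + 1 = 1 - α by ring, zero_rpow h1'.ne']
    ring
  refine core α ε d h0 h1 hε hd W hW (by simp [hWd, hXt])
    (fun v hv => hWp v ⟨hv.1, hv.2.trans hεt.le⟩) (fun u hu => ?_)
  have k := h u hu
  have c0 := conv 0
  simp only [sub_zero] at c0
  rw [conv u, c0] at k
  have mono : (t - u) ^ (1 - α) / (1 - α) ≤ t ^ (1 - α) / (1 - α) :=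
    div_le_div_of_nonneg_right
      (rpow_le_rpow (by linarith [hu.2]) (by linarith [hu.1]) h1'.le) h1'.le
  have mono2 := mul_le_mul_of_nonneg_left mono hc
  have s1 := intervalIntegral.integral_add_adjacent_intervals (sing_int0 α 0 ε h1 W hW)
    (sing_int0 α ε t h1 W hW)
  have s2 := intervalIntegral.integral_add_adjacent_intervals (sing_int α u u ε h1 W hW)
    (sing_int α u ε t h1 W hW)
  have s3 : ∫ v in ε..t, v ^ (-α) * W v ≤ ∫ v in ε..t, (v - u) ^ (-α) * W v := by
    refine intervalIntegral.integral_mono_on hεt.le (sing_int0 α ε t h1 W hW)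
      (sing_int α u ε t h1 W hW) (fun v hv => ?_)
    refine mul_le_mul_of_nonneg_right ?_ (hWp v ⟨hε.le.trans hv.1, hv.2⟩)
    exact rpow_le_rpow_of_nonpos (by linarith [hu.2, hv.1]) (by linarith [hu.1]) (by linarith)
  linarith
/-- Fractional comparison lemma: if `x` vanishes for the first time at `t₁` from below,
then its Caputo derivative at `t₁` is nonnegative. -/
theorem caputo_nonneg_at_first_zero (α T : ℝ) (hα : α ∈ Set.Ioc (0:ℝ) 1) (hT : 0 < T)
    (x : ℝ → ℝ) (hx : ContinuousOn x (Set.Icc 0 T))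
    (hdiff : ∀ t ∈ Set.Ioc 0 T, DifferentiableAt ℝ (caputoKernel α x) t)
    (t₁ : ℝ) (ht₁ : t₁ ∈ Set.Ioc 0 T) (hx1 : x t₁ = 0)
    (hneg : ∀ t ∈ Set.Ico 0 t₁, x t < 0) :
    0 ≤ caputo α x t₁ := by

  by_contra hcon
  push Not at hcon
  have hα1 : α < 1 := by
    rcases hα.2.eq_or_lt with h | h
    · exfalso
      have : caputoKernel α x = fun _ => 0 := by
        funext s; simp [caputoKernel, h, Real.Gamma_zero]
      simp [caputo, this] at hcon
    · exact h
  have h1' : 0 < 1 - α := by linarith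
  have hΓ : 0 < Real.Gamma (1 - α) := Real.Gamma_pos_of_pos h1'
  have hD := (hdiff t₁ ht₁).hasDerivAt
  change deriv (caputoKernel α x) t₁ < 0 at hcon
  set D := deriv (caputoKernel α x) t₁ with hDd
  have ev := (hasDerivAt_iff_tendsto_slope.1 hD).eventually_lt_const (show D < D / 2 by linarith)
  obtain ⟨δ, hδ, hδ2⟩ := Metric.mem_nhdsWithin_iff.1 ev
  have ht0 := ht₁.1
  set ε := min δ t₁ / 2 with hε
  have hm : 0 < min δ t₁ := lt_min hδ ht0
  have hε0 : 0 < ε := by positivity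
  have hεδ : ε < δ := by have := min_le_left δ t₁; linarith
  have hεt : ε < t₁ := by have := min_le_right δ t₁; linarith
  set X : ℝ → ℝ := IccExtend hT.le (restrict (Icc 0 T) x) with hXd
  have hXc : Continuous X := (continuousOn_iff_continuous_restrict.1 hx).Icc_extend'
  have hXe : ∀ s ∈ Icc 0 T, X s = x s := fun s hs => by
    rw [hXd, IccExtend_of_mem _ _ hs]; rfl
  have hK : ∀ s ∈ Icc 0 T, (∫ r in (0:ℝ)..s, (s - r) ^ (-α) * (X r - X 0)) =
      Real.Gamma (1 - α) * caputoKernel α x s := by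
    intro s hs
    rw [caputoKernel, ← mul_assoc, mul_one_div_cancel hΓ.ne', one_mul]
    refine intervalIntegral.integral_congr (fun r hr => ?_)
    rw [uIcc_of_le hs.1] at hr
    rw [hXe r ⟨hr.1, hr.2.trans hs.2⟩, hXe 0 ⟨le_rfl, hT.le⟩]
  refine reduction α ε (Real.Gamma (1 - α) * (-D / 2)) t₁ hα.1 hα1 hε0 hεt
    (mul_pos hΓ (by linarith)) X hXc ?_ ?_ ?_
  · rw [hXe t₁ ⟨ht0.le, ht₁.2⟩, hx1]
  · intro s hs
    rw [hXe s ⟨hs.1, hs.2.trans ht₁.2⟩]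
    rcases hs.2.eq_or_lt with h | h
    · rw [h, hx1]
    · exact (hneg s ⟨hs.1, h⟩).le
  · intro u hu
    rw [hK t₁ ⟨ht0.le, ht₁.2⟩, hK (t₁ - u) ⟨by linarith [hu.2], by linarith [hu.1, ht₁.2]⟩]
    have hs : slope (caputoKernel α x) t₁ (t₁ - u) < D / 2 := by
      refine hδ2 ⟨?_, ?_⟩
      · rw [Metric.mem_ball, Real.dist_eq, show t₁ - u - t₁ = -u by ring, abs_neg,
          abs_of_pos hu.1]
        exact hu.2.trans hεδ
      · intro h
        have : t₁ - u = t₁ := h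
        linarith [hu.1]
    rw [slope_def_field, show t₁ - u - t₁ = -u by ring, div_lt_iff_of_neg (by linarith [hu.1])] at hs
    have := mul_le_mul_of_nonneg_left hs.le hΓ.le
    linarith
end

section
/- Let α ∈ (0,1) and let x : [0,∞) → ℝ^n be continuous with Caputo fractional derivative D^α_{0+} x existing on (0,∞). Then for all t > 0, D^α_{0+}(‖x(t)‖²) ≤ 2 ⟨x(t), D^α_{0+} x(t)⟩, where ⟨·,·⟩ is the Euclidean inner product. -/
open Real MeasureTheory Set

lemma kint {β : ℝ} (h : -1 < β) (s a b : ℝ) :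
    IntervalIntegrable (fun r : ℝ => (s - r) ^ β) volume a b := by
  have := (intervalIntegral.intervalIntegrable_rpow' h (a := s - a) (b := s - b)).comp_sub_left s
  simpa using this

lemma kint' {β : ℝ} (h : -1 < β) (s a b : ℝ) :
    IntervalIntegrable (fun r : ℝ => (r - s) ^ β) volume a b := by
  have := (intervalIntegral.intervalIntegrable_rpow' h (a := a - s) (b := b - s)).comp_sub_right s
  simpa using this

lemma kint_mul {β : ℝ} (h : -1 < β) (s a b : ℝ) {z : ℝ → ℝ} (hz : Continuous z) :
    IntervalIntegrable (fun r : ℝ => (s - r) ^ β * z r) volume a b :=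
  (kint h s a b).mul_continuousOn hz.continuousOn

lemma beta_int {α : ℝ} (h0 : 0 < α) (h1 : α < 1) {q s : ℝ} (hqs : q < s) :
    IntervalIntegrable (fun r : ℝ => (s - r) ^ (α - 1) * (r - q) ^ (-α)) volume q s := by
  set m := (q + s) / 2 with hm
  have hqm : q < m := by rw [hm]; linarith
  have hms : m < s := by rw [hm]; linarith
  refine IntervalIntegrable.trans (b := m) ?_ ?_
  · refine (kint' (by linarith) q q m).continuousOn_mul ?_
    refine ContinuousOn.rpow_const (by fun_prop) ?_
    intro r hr
    rw [uIcc_of_le hqm.le] at hr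
    left; have := hr.2; intro h; linarith
  · refine (kint (by linarith) s m s).mul_continuousOn ?_
    refine ContinuousOn.rpow_const (by fun_prop) ?_
    intro r hr
    rw [uIcc_of_le hms.le] at hr
    left; have := hr.1; intro h; linarith

lemma beta_val {α : ℝ} {q s : ℝ} (hqs : q < s) :
    ∫ r in q..s, (s - r) ^ (α - 1) * (r - q) ^ (-α) =
      ∫ v in (0:ℝ)..1, (1 - v) ^ (α - 1) * v ^ (-α) := by
  have hd : 0 < s - q := by linarith
  have := intervalIntegral.integral_comp_mul_add (a := 0) (b := 1)
    (fun r : ℝ => (s - r) ^ (α - 1) * (r - q) ^ (-α)) hd.ne' q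
  simp only [mul_zero, zero_add, mul_one, sub_add_cancel, smul_eq_mul] at this
  have h2 : ∫ r in q..s, (s - r) ^ (α - 1) * (r - q) ^ (-α) =
     (s - q) * ∫ x in (0:ℝ)..1, (s - ((s - q) * x + q)) ^ (α - 1) * ((s - q) * x + q - q) ^ (-α) := by
    rw [this]; field_simp
  rw [h2, ← intervalIntegral.integral_const_mul]
  refine intervalIntegral.integral_congr ?_
  intro v hv
  rw [uIcc_of_le zero_le_one] at hv
  have e1 : s - ((s - q) * v + q) = (s - q) * (1 - v) := by ring
  have e2 : (s - q) * v + q - q = (s - q) * v := by ring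
  simp only [e1, e2]
  rw [mul_rpow hd.le (by linarith [hv.2]), mul_rpow hd.le hv.1]
  have : (s - q) * (s - q) ^ (α - 1) * (s - q) ^ (-α) = 1 := by
    nth_rewrite 1 [← rpow_one (s - q)]
    rw [← rpow_add hd, ← rpow_add hd]
    ring_nf; simp
  linear_combination ((1 - v) ^ (α - 1) * v ^ (-α)) * this

lemma abel {α : ℝ} (h0 : 0 < α) (h1 : α < 1) {z : ℝ → ℝ} (hz : Continuous z) (hz0 : ∀ r, 0 ≤ z r)
    {p s : ℝ} (hps : p ≤ s) :
    IntervalIntegrable (fun r => (s - r) ^ (α - 1) * ∫ q in p..r, (r - q) ^ (-α) * z q) volume p s ∧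
    ∫ r in p..s, (s - r) ^ (α - 1) * ∫ q in p..r, (r - q) ^ (-α) * z q =
      (∫ v in (0:ℝ)..1, (1 - v) ^ (α - 1) * v ^ (-α)) * ∫ q in p..s, z q := by
  set C := ∫ v in (0:ℝ)..1, (1 - v) ^ (α - 1) * v ^ (-α) with hC
  set S : Set (ℝ × ℝ) := {w | p < w.2 ∧ w.2 < w.1 ∧ w.1 < s} with hS
  have hSm : MeasurableSet S := by
    refine (measurableSet_lt measurable_const measurable_snd).inter
      ((measurableSet_lt measurable_snd measurable_fst).inter
       (measurableSet_lt measurable_fst measurable_const))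
  set F : ℝ × ℝ → ℝ := S.indicator
    (fun w => (s - w.1) ^ (α - 1) * (w.1 - w.2) ^ (-α) * z w.2) with hF
  have hFm : Measurable F := by
    refine Measurable.indicator ?_ hSm
    have := hz.measurable
    fun_prop
  have hF0 : ∀ w, 0 ≤ F w := by
    intro w
    refine indicator_nonneg ?_ w
    rintro w ⟨a, b, c⟩
    have := hz0 w.2
    have := rpow_nonneg (sub_nonneg.2 b.le) (-α)
    have := rpow_nonneg (sub_nonneg.2 c.le) (α - 1)
    positivity
  -- sections in r
  have hq1 : ∀ q, p < q → (fun r => F (r, q)) =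
      (Ioo q s).indicator (fun r => (s - r) ^ (α - 1) * (r - q) ^ (-α) * z q) := by
    intro q hq; ext r
    simp [hF, indicator, hS, hq]
  have hq2 : ∀ q, ¬ (p < q ∧ q < s) → (fun r => F (r, q)) = 0 := by
    intro q hq; ext r
    have : (r, q) ∉ S := fun h => hq ⟨h.1, h.2.1.trans h.2.2⟩
    simp [hF, this]
  have hqi : ∀ q, Integrable (fun r => F (r, q)) := by
    intro q
    by_cases h : p < q ∧ q < s
    · rw [hq1 q h.1, integrable_indicator_iff measurableSet_Ioo]
      exact ((intervalIntegrable_iff_integrableOn_Ioo_of_le h.2.le).1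
        ((beta_int h0 h1 h.2).mul_const (z q)))
    · rw [hq2 q h]; exact integrable_zero _ _ _
  have hqv : (fun q => ∫ r, F (r, q)) = (Ioo p s).indicator (fun q => C * z q) := by
    ext q
    by_cases h : p < q ∧ q < s
    · rw [hq1 q h.1, integral_indicator measurableSet_Ioo, indicator_of_mem (by exact h),
        ← integral_Ioc_eq_integral_Ioo, ← intervalIntegral.integral_of_le h.2.le,
        intervalIntegral.integral_mul_const, beta_val h.2]
    · rw [hq2 q h, indicator_of_notMem (by exact h)]; simp
  have hri : ∀ r, ∫ q, F (r, q) = (Ioo p s).indicator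
      (fun r => (s - r) ^ (α - 1) * ∫ q in p..r, (r - q) ^ (-α) * z q) r := by
    intro r
    by_cases h : p < r ∧ r < s
    · have : (fun q => F (r, q)) =
        (Ioo p r).indicator (fun q => (s - r) ^ (α - 1) * ((r - q) ^ (-α) * z q)) := by
        ext q
        simp [hF, indicator, hS, h.2, mul_assoc]
      rw [this, integral_indicator measurableSet_Ioo, indicator_of_mem (by exact h),
        ← integral_Ioc_eq_integral_Ioo, ← intervalIntegral.integral_of_le h.1.le,
        intervalIntegral.integral_const_mul]
    · have : (fun q => F (r, q)) = 0 := by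
        ext q
        have : (r, q) ∉ S := fun h' => h ⟨h'.1.trans h'.2.1, h'.2.2⟩
        simp [hF, this]
      rw [this, indicator_of_notMem (by exact h)]; simp
  have hFi : Integrable F (volume.prod volume) := by
    rw [integrable_prod_iff' hFm.aestronglyMeasurable]
    refine ⟨Filter.Eventually.of_forall hqi, ?_⟩
    simp only [norm_of_nonneg (hF0 _)]
    rw [hqv, integrable_indicator_iff measurableSet_Ioo]
    exact ((intervalIntegrable_iff_integrableOn_Ioo_of_le hps).1
      ((hz.const_mul C).intervalIntegrable _ _))
  constructor
  · rw [intervalIntegrable_iff_integrableOn_Ioo_of_le hps, ← integrable_indicator_iff measurableSet_Ioo]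
    have := hFi.integral_prod_left
    simpa only [hri] using this
  · have := integral_integral_swap (f := fun r q => F (r, q)) hFi
    simp only [hri] at this
    rw [hqv, integral_indicator measurableSet_Ioo, integral_indicator measurableSet_Ioo,
        ← integral_Ioc_eq_integral_Ioo, ← intervalIntegral.integral_of_le hps,
        ← integral_Ioc_eq_integral_Ioo, ← intervalIntegral.integral_of_le hps,
        intervalIntegral.integral_const_mul] at this
    exact this

lemma M_val {α : ℝ} (h0 : 0 < α) (c b : ℝ) {p s : ℝ} (hps : p ≤ s) :
    ∫ r in p..s, (s - r) ^ (α - 1) * (c + b * (r - p)) =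
      (c + b * (s - p)) * (s - p) ^ α / α - b * (s - p) ^ (α + 1) / (α + 1) := by
  have e := intervalIntegral.integral_comp_sub_left (a := p) (b := s)
    (fun v : ℝ => v ^ (α - 1) * (c + b * (s - v - p))) s
  simp only [sub_sub_cancel, sub_self] at e
  rw [e]
  have e2 : ∫ v in (0:ℝ)..(s - p), v ^ (α - 1) * (c + b * (s - v - p)) =
      ∫ v in (0:ℝ)..(s - p), ((c + b * (s - p)) * v ^ (α - 1) - b * v ^ α) := by
    refine intervalIntegral.integral_congr ?_
    intro v hv
    rw [uIcc_of_le (by linarith)] at hv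
    have : v ^ α = v ^ (α - 1) * v := by
      rcases eq_or_lt_of_le hv.1 with h | h
      · rw [← h, zero_rpow h0.ne']; simp
      · rw [rpow_sub_one h.ne']; field_simp
    simp only [this]; ring
  rw [e2, intervalIntegral.integral_sub, intervalIntegral.integral_const_mul,
    intervalIntegral.integral_const_mul, integral_rpow (by left; linarith),
    integral_rpow (by left; linarith)]
  · have : α - 1 + 1 = α := by ring
    rw [this, zero_rpow h0.ne', zero_rpow (by linarith)]
    ring
  · exact (intervalIntegral.intervalIntegrable_rpow' (by linarith)).const_mul _
  · exact (intervalIntegral.intervalIntegrable_rpow' (by linarith)).const_mul _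

lemma J_diff {α : ℝ} (h0 : 0 < α) (h1 : α < 1) {z : ℝ → ℝ} (hz : Continuous z)
    (hz0 : ∀ r, 0 ≤ z r) {p r t ε : ℝ} (hpr : p ≤ r) (hrt : r ≤ t)
    (hε : ∀ q ∈ Icc r t, z q ≤ ε) :
    (∫ q in p..t, (t - q) ^ (-α) * z q) - (∫ q in p..r, (r - q) ^ (-α) * z q)
      ≤ ε / (1 - α) * (t - r) ^ (1 - α) := by
  have hk : -1 < -α := by linarith
  rw [← intervalIntegral.integral_add_adjacent_intervals (kint_mul hk t p r hz)
    (kint_mul hk t r t hz)]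
  have i1 : ∫ q in p..r, (t - q) ^ (-α) * z q ≤ ∫ q in p..r, (r - q) ^ (-α) * z q := by
    refine intervalIntegral.integral_mono_on_of_le_Ioo hpr (kint_mul hk t p r hz)
      (kint_mul hk r p r hz) ?_
    intro q hq
    refine mul_le_mul_of_nonneg_right ?_ (hz0 q)
    exact rpow_le_rpow_of_nonpos (by linarith [hq.2]) (by linarith) (by linarith)
  have i2 : ∫ q in r..t, (t - q) ^ (-α) * z q ≤ ∫ q in r..t, (t - q) ^ (-α) * ε := by
    refine intervalIntegral.integral_mono_on_of_le_Ioo hrt (kint_mul hk t r t hz)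
      ((kint hk t r t).mul_const ε) ?_
    intro q hq
    exact mul_le_mul_of_nonneg_left (hε q ⟨hq.1.le, hq.2.le⟩)
      (rpow_nonneg (by linarith [hq.2]) _)
  have i3 : ∫ q in r..t, (t - q) ^ (-α) * ε = ε / (1 - α) * (t - r) ^ (1 - α) := by
    rw [intervalIntegral.integral_mul_const,
      intervalIntegral.integral_comp_sub_left (fun v : ℝ => v ^ (-α)) t,
      integral_rpow (by left; linarith)]
    have : -α + 1 = 1 - α := by ring
    rw [this, sub_self, zero_rpow (by linarith)]
    ring
  linarith

lemma core_s13 {α : ℝ} (h0 : 0 < α) (h1 : α < 1) {z : ℝ → ℝ} (hz : Continuous z)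
    (hz0 : ∀ r, 0 ≤ z r) {p t b : ℝ} (hpt : p < t) (hzt : z t = 0) (hb : 0 < b)
    (h : ∀ r ∈ Icc p t, b * (t - r) ≤
      (∫ q in p..t, (t - q) ^ (-α) * z q) - (∫ q in p..r, (r - q) ^ (-α) * z q)) : False := by
  set J : ℝ → ℝ := fun r => ∫ q in p..r, (r - q) ^ (-α) * z q with hJ
  change ∀ r ∈ Icc p t, b * (t - r) ≤ J t - J r at h
  set c := J t - b * (t - p) with hc
  have hc0 : 0 ≤ c := by
    have := h p ⟨le_rfl, hpt.le⟩
    have hp : J p = 0 := by simp [hJ]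
    rw [hp] at this; linarith
  set C := ∫ v in (0:ℝ)..1, (1 - v) ^ (α - 1) * v ^ (-α) with hC
  set Mf : ℝ → ℝ := fun s =>
    (c + b * (s - p)) * (s - p) ^ α / α - b * (s - p) ^ (α + 1) / (α + 1) with hMf
  set φ : ℝ → ℝ := fun s => C * (∫ q in p..s, z q) - Mf s with hφ
  set m := b * (t - p) ^ α / α + c * (t - p) ^ (α - 1) with hm
  have htp : 0 < t - p := by linarith
  have hm0 : 0 < m := by
    have := rpow_pos_of_pos htp α
    have := rpow_pos_of_pos htp (α - 1)
    positivity
  have hφd : HasDerivAt φ (-m) t := by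
    have d1 : HasDerivAt (fun s => ∫ q in p..s, z q) (z t) t :=
      intervalIntegral.integral_hasDerivAt_right (hz.intervalIntegrable _ _)
        (hz.stronglyMeasurableAtFilter _ _) hz.continuousAt
    have d0 : HasDerivAt (fun s : ℝ => s - p) 1 t := (hasDerivAt_id t).sub_const p
    have d2 : HasDerivAt (fun s : ℝ => (s - p) ^ α) _ t :=
      d0.rpow_const (p := α) (Or.inl htp.ne')
    have d3 : HasDerivAt (fun s : ℝ => (s - p) ^ (α + 1)) _ t :=
      d0.rpow_const (p := α + 1) (Or.inl htp.ne')
    have d4 := ((((d0.const_mul b).const_add c).mul d2).div_const α).sub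
      ((d3.const_mul b).div_const (α + 1))
    have d5 := (d1.const_mul C).sub d4
    refine d5.congr_deriv ?_
    have e : (t - p) ^ α = (t - p) ^ (α - 1) * (t - p) := by
      rw [rpow_sub_one htp.ne']; field_simp
    have e' : α + 1 - 1 = α := by ring
    rw [hzt, hm, e', e]
    field_simp
    ring
  have hE0 : ∀ r ∈ Icc p t, 0 ≤ c + b * (r - p) - J r := by
    intro r hr
    have := h r hr
    rw [hc]; linarith
  have hLi : ∀ s, IntervalIntegrable (fun r => (s - r) ^ (α - 1) * (c + b * (r - p))) volume p s :=
    fun s => kint_mul (by linarith) s p s (by fun_prop)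
  have hEi : ∀ s, p ≤ s →
      IntervalIntegrable (fun r => (s - r) ^ (α - 1) * (c + b * (r - p) - J r)) volume p s := by
    intro s hs
    simp only [mul_sub _ _ (J _)]
    exact (hLi s).sub (abel h0 h1 hz hz0 hs).1
  have hφv : ∀ s, p ≤ s → φ s = - ∫ r in p..s, (s - r) ^ (α - 1) * (c + b * (r - p) - J r) := by
    intro s hs
    simp only [mul_sub _ _ (J _)]
    rw [intervalIntegral.integral_sub (hLi s) (abel h0 h1 hz hz0 hs).1, M_val h0 c b hs,
      (abel h0 h1 hz hz0 hs).2]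
    simp only [hφ, hMf]; ring
  set ε := m * (1 - α) / 2 with hε
  have hε0 : 0 < ε := by
    have : 0 < 1 - α := by linarith
    positivity
  obtain ⟨η, hη, hηz⟩ : ∃ η > 0, ∀ q, |q - t| < η → z q < ε := by
    have := Metric.continuousAt_iff.1 (hz.continuousAt (x := t)) ε hε0
    obtain ⟨η, hη, H⟩ := this
    refine ⟨η, hη, fun q hq => ?_⟩
    have := H (x := q) (by rwa [Real.dist_eq])
    rw [Real.dist_eq, hzt, sub_zero] at this
    exact (le_abs_self _).trans_lt this
  have key : ∀ s, p < s → t - η < s → s < t → - (m / 2) * (t - s) ≤ φ t - φ s := by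
    intro s hps hηs hst
    rw [hφv t hpt.le, hφv s hps.le]
    have hti := hEi t hpt.le
    have hi1 : IntervalIntegrable (fun r => (t - r) ^ (α - 1) * (c + b * (r - p) - J r)) volume p s :=
      hti.mono_set (by rw [uIcc_of_le hps.le, uIcc_of_le hpt.le]; exact Icc_subset_Icc_right hst.le)
    have hi2 : IntervalIntegrable (fun r => (t - r) ^ (α - 1) * (c + b * (r - p) - J r)) volume s t :=
      hti.mono_set (by rw [uIcc_of_le hst.le, uIcc_of_le hpt.le]; exact Icc_subset_Icc_left hps.le)
    rw [← intervalIntegral.integral_add_adjacent_intervals hi1 hi2]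
    have j1 : ∫ r in p..s, (t - r) ^ (α - 1) * (c + b * (r - p) - J r) ≤
        ∫ r in p..s, (s - r) ^ (α - 1) * (c + b * (r - p) - J r) := by
      refine intervalIntegral.integral_mono_on_of_le_Ioo hps.le hi1 (hEi s hps.le) ?_
      intro r hr
      refine mul_le_mul_of_nonneg_right ?_ (hE0 r ⟨hr.1.le, hr.2.le.trans hst.le⟩)
      exact rpow_le_rpow_of_nonpos (by linarith [hr.2]) (by linarith) (by linarith)
    have j2 : ∫ r in s..t, (t - r) ^ (α - 1) * (c + b * (r - p) - J r) ≤
        ∫ r in s..t, m / 2 := by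
      refine intervalIntegral.integral_mono_on_of_le_Ioo hst.le hi2 (by simp) ?_
      intro r hr
      have hrt : 0 < t - r := by linarith [hr.2]
      have jd := J_diff h0 h1 hz hz0 (p := p) (r := r) (t := t) (ε := ε)
        (by linarith [hr.1]) hr.2.le (by
          intro q hq
          refine (hηz q ?_).le
          rw [abs_lt]; constructor <;> linarith [hq.1, hq.2, hr.1])
      change J t - J r ≤ _ at jd
      have hεm : ε / (1 - α) = m / 2 := by
        have : 1 - α ≠ 0 := by linarith
        rw [hε]; field_simp
      rw [hεm] at jd
      have : c + b * (r - p) - J r ≤ m / 2 * (t - r) ^ (1 - α) := by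
        have : 0 ≤ b * (t - r) := by positivity
        rw [hc]; linarith
      calc (t - r) ^ (α - 1) * (c + b * (r - p) - J r)
          ≤ (t - r) ^ (α - 1) * (m / 2 * (t - r) ^ (1 - α)) :=
            mul_le_mul_of_nonneg_left this (rpow_nonneg hrt.le _)
        _ = m / 2 * ((t - r) ^ (α - 1) * (t - r) ^ (1 - α)) := by ring
        _ = m / 2 := by rw [← rpow_add hrt]; ring_nf; simp
    rw [intervalIntegral.integral_const, smul_eq_mul] at j2
    linarith
  have hs := (hasDerivAt_iff_tendsto_slope.1 hφd).mono_left
    (nhdsWithin_mono t (fun s (hs : s < t) => hs.ne) : nhdsWithin t (Iio t) ≤ _)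
  have : -(m / 2) ≤ -m := by
    refine ge_of_tendsto hs ?_
    filter_upwards [Ioo_mem_nhdsLT (show max p (t - η) < t from max_lt hpt (by linarith))] with s hs
    have hs1 := (max_lt_iff.1 hs.1)
    have := key s hs1.1 hs1.2 hs.2
    rw [slope_comm, slope_def_field, le_div_iff₀ (by linarith [hs.2])]
    exact this
  linarith

lemma left_bound {α : ℝ} (h1 : α < 1) (h0 : 0 < α) {y : ℝ → ℝ} (hy : Continuous y)
    (hy0 : ∀ r, 0 ≤ y r) {p r t : ℝ} (hp : 0 ≤ p) (hpr : p ≤ r) (hrt : r ≤ t) :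
    (∫ q in (0:ℝ)..t, (t - q) ^ (-α) * y q) - (∫ q in (0:ℝ)..r, (r - q) ^ (-α) * y q) ≤
    (∫ q in p..t, (t - q) ^ (-α) * y q) - (∫ q in p..r, (r - q) ^ (-α) * y q) := by
  have hk : -1 < -α := by linarith
  rw [← intervalIntegral.integral_add_adjacent_intervals (kint_mul hk t 0 p hy)
    (kint_mul hk t p t hy), ← intervalIntegral.integral_add_adjacent_intervals
    (kint_mul hk r 0 p hy) (kint_mul hk r p r hy)]
  have : ∫ q in (0:ℝ)..p, (t - q) ^ (-α) * y q ≤ ∫ q in (0:ℝ)..p, (r - q) ^ (-α) * y q := by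
    refine intervalIntegral.integral_mono_on_of_le_Ioo hp (kint_mul hk _ _ _ hy)
      (kint_mul hk _ _ _ hy) ?_
    intro q hq
    refine mul_le_mul_of_nonneg_right ?_ (hy0 q)
    exact rpow_le_rpow_of_nonpos (by linarith [hq.2]) (by linarith) (by linarith)
  linarith

lemma caputo_nonpos {α : ℝ} (h0 : 0 < α) (h1 : α < 1) {y : ℝ → ℝ} (hy : Continuous y)
    (hy0 : ∀ r, 0 ≤ y r) {t d : ℝ} (ht : 0 < t) (hyt : y t = 0)
    (hd : HasDerivAt (caputoKernel α y) d t) : d ≤ 0 := by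
  by_contra! hd0
  have hk : -1 < -α := by linarith
  have hG : 0 < Real.Gamma (1 - α) := Real.Gamma_pos_of_pos (by linarith)
  have hα' : 1 - α ≠ 0 := by linarith
  set J : ℝ → ℝ := fun s => ∫ q in (0:ℝ)..s, (s - q) ^ (-α) * y q with hJ
  have hJe : ∀ s, 0 < s → J s = Real.Gamma (1 - α) * caputoKernel α y s
      + y 0 * (s ^ (1 - α) / (1 - α)) := by
    intro s hs
    have e : ∫ r in (0:ℝ)..s, (s - r) ^ (-α) = s ^ (1 - α) / (1 - α) := by
      rw [intervalIntegral.integral_comp_sub_left (fun v : ℝ => v ^ (-α)) s,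
        integral_rpow (by left; linarith)]
      have : -α + 1 = 1 - α := by ring
      rw [this, sub_self, zero_rpow hα', sub_zero, sub_zero]
    unfold caputoKernel
    simp only [mul_sub]
    rw [intervalIntegral.integral_sub (kint_mul hk _ _ _ hy) ((kint hk _ _ _).mul_const _),
      intervalIntegral.integral_mul_const, e]
    field_simp
    ring
  set a := Real.Gamma (1 - α) * d + y 0 * t ^ (-α) with ha
  have ha0 : 0 < a := by
    have := hy0 0
    have := rpow_pos_of_pos ht (-α)
    positivity
  have hJd : HasDerivAt J a t := by
    have d1 : HasDerivAt (fun s : ℝ => s ^ (1 - α)) ((1 - α) * t ^ (1 - α - 1)) t :=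
      Real.hasDerivAt_rpow_const (Or.inl ht.ne')
    have d2 := (hd.const_mul (Real.Gamma (1 - α))).add ((d1.div_const (1 - α)).const_mul (y 0))
    refine (d2.congr_deriv ?_).congr_of_eventuallyEq ?_
    · have : 1 - α - 1 = -α := by ring
      rw [this, ha]; field_simp
    · filter_upwards [lt_mem_nhds ht] with s hs
      simpa using hJe s hs
  have hs := (hasDerivAt_iff_tendsto_slope.1 hJd).mono_left
    (nhdsWithin_mono t (fun s (hs : s < t) => hs.ne) : nhdsWithin t (Iio t) ≤ _)
  have hev := (hs.eventually (lt_mem_nhds (show a / 2 < a by linarith))).and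
    (Ioo_mem_nhdsLT ht)
  obtain ⟨l, hl, hlt⟩ := (mem_nhdsLT_iff_exists_Ioo_subset' ht).1 hev
  set p := (l + t) / 2 with hp
  have hlt' : l < t := hl
  have hlp : l < p := by rw [hp]; linarith
  have hpt : p < t := by rw [hp]; linarith
  have hp0 : 0 < p := (hlt (show p ∈ Ioo l t from ⟨hlp, hpt⟩)).2.1
  refine core_s13 h0 h1 hy hy0 hpt hyt (half_pos ha0) ?_
  intro r hr
  refine le_trans ?_ (left_bound h1 h0 hy hy0 hp0.le hr.1 hr.2)
  change a / 2 * (t - r) ≤ J t - J r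
  rcases eq_or_lt_of_le hr.2 with h | h
  · rw [h]; simp
  · have := (hlt (show r ∈ Ioo l t from ⟨hlp.trans_le hr.1, h⟩)).1
    rw [slope_comm, slope_def_field, lt_div_iff₀ (by linarith)] at this
    exact this.le

/-- Caputo derivative product inequality: `D^α ‖x‖² ≤ 2 ⟨x, D^α x⟩`. -/
theorem caputo_norm_sq_le (n : ℕ) (α : ℝ) (hα : α ∈ Set.Ioo (0:ℝ) 1)
    (x : ℝ → EuclideanSpace ℝ (Fin n)) (hx : Continuous x)
    (hdiff : ∀ t > 0, ∀ i, DifferentiableAt ℝ (caputoKernel α (fun s => x s i)) t)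
    (hdiff2 : ∀ t > 0, DifferentiableAt ℝ (caputoKernel α (fun s => ‖x s‖ ^ 2)) t)
    (t : ℝ) (ht : 0 < t) :
    caputo α (fun s => ‖x s‖ ^ 2) t ≤ 2 * ∑ i, x t i * caputo α (fun s => x s i) t := by 
  obtain ⟨h0, h1⟩ := hα
  have hk : -1 < -α := by linarith
  set y : ℝ → ℝ := fun s => ‖x s - x t‖ ^ 2 with hy
  have hxi : ∀ i, Continuous (fun s => x s i) := fun i => by fun_prop
  have hn : Continuous (fun s => ‖x s‖ ^ 2) := by fun_prop
  have hyx : ∀ s, y s = ‖x s‖ ^ 2 - 2 * ∑ i, x t i * x s i + ‖x t‖ ^ 2 := by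
    intro s
    rw [hy]
    simp only [EuclideanSpace.norm_sq_eq, PiLp.sub_apply, Real.norm_eq_abs, sq_abs]
    rw [Finset.mul_sum, ← Finset.sum_sub_distrib, ← Finset.sum_add_distrib]
    refine Finset.sum_congr rfl fun i _ => ?_
    ring
  have hK : ∀ s, caputoKernel α y s = caputoKernel α (fun s => ‖x s‖ ^ 2) s
      - 2 * ∑ i, x t i * caputoKernel α (fun s => x s i) s := by
    intro s
    unfold caputoKernel
    have e : ∀ r, (s - r) ^ (-α) * (y r - y 0) =
        (s - r) ^ (-α) * (‖x r‖ ^ 2 - ‖x 0‖ ^ 2)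
          - ∑ i, (2 * x t i) * ((s - r) ^ (-α) * (x r i - x 0 i)) := by
      intro r
      have : ∑ i, (2 * x t i) * ((s - r) ^ (-α) * (x r i - x 0 i)) =
          (s - r) ^ (-α) * (2 * ∑ i, x t i * x r i - 2 * ∑ i, x t i * x 0 i) := by
        rw [Finset.mul_sum, Finset.mul_sum, ← Finset.sum_sub_distrib, Finset.mul_sum]
        refine Finset.sum_congr rfl fun i _ => ?_
        ring
      rw [this, hyx, hyx]; ring
    have hii : ∀ i, IntervalIntegrable
        (fun r => (2 * x t i) * ((s - r) ^ (-α) * (x r i - x 0 i))) volume 0 s := fun i =>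
      (kint_mul hk s 0 s ((hxi i).sub continuous_const)).const_mul _
    have hsum : IntervalIntegrable
        (fun r => ∑ i, (2 * x t i) * ((s - r) ^ (-α) * (x r i - x 0 i))) volume 0 s := by
      have h := IntervalIntegrable.sum Finset.univ (fun i _ => hii i)
      have h' : (∑ i, fun r => (2 * x t i) * ((s - r) ^ (-α) * (x r i - x 0 i))) =
        (fun r => ∑ i, (2 * x t i) * ((s - r) ^ (-α) * (x r i - x 0 i))) := by
        ext r; simp only [Finset.sum_apply]
      rw [← h']; exact h
    simp only [e]
    rw [intervalIntegral.integral_sub (kint_mul hk s 0 s (z := fun r => ‖x r‖ ^ 2 - ‖x 0‖ ^ 2) (by fun_prop))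
      hsum,
      intervalIntegral.integral_finsetSum (fun i _ => hii i), mul_sub, Finset.mul_sum,
      Finset.mul_sum]
    congr 1
    refine Finset.sum_congr rfl fun i _ => ?_
    rw [intervalIntegral.integral_const_mul]
    ring
  have hd : HasDerivAt (caputoKernel α y) (caputo α (fun s => ‖x s‖ ^ 2) t
      - 2 * ∑ i, x t i * caputo α (fun s => x s i) t) t := by
    rw [funext hK]
    refine (hdiff2 t ht).hasDerivAt.sub (HasDerivAt.const_mul 2 ?_)
    exact HasDerivAt.fun_sum fun i _ => (hdiff t ht i).hasDerivAt.const_mul (x t i)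
  have := caputo_nonpos h0 h1 (y := y) (by fun_prop) (fun r => by positivity) ht (by simp [hy]) hd
  linarith
end

section
/- Positivity of coupled fractional delay systems: Consider the system D^α_{0+} x(t) = A x(t) + B x(t−τ₁) + E y(t−τ₂) for t > 0 and y(t) = C x(t) + D y(t−τ₃) for t ≥ 0 with continuous nonnegative initial functions φ, ψ on [−τ, 0] satisfying the compatibility condition C φ(0) + D ψ(−τ₃) = ψ(0). If A is Metzler and B, E, C, D are entrywise nonnegative, then the solution satisfies x(t) ∈ ℝ^d_{≥0} and y(t) ∈ ℝ^n_{≥0} for all t ≥ 0. -/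
open Real MeasureTheory Set

noncomputable def JJ (a : ℝ) (f : ℝ → ℝ) (t : ℝ) : ℝ := ∫ r in (0:ℝ)..t, (t - r) ^ (a - 1) * f r

noncomputable def kap (a b : ℝ) : ℝ := ∫ r in (0:ℝ)..1, (1 - r) ^ (a - 1) * r ^ (b - 1)

lemma ker_int {a : ℝ} (ha : 0 < a) (t p q : ℝ) :
    IntervalIntegrable (fun r => (t - r) ^ (a - 1)) volume p q := by
  have h := (intervalIntegral.intervalIntegrable_rpow' (a := t - p) (b := t - q)
    (r := a - 1) (by linarith)).comp_sub_left t
  simpa using h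

lemma ker_mul_int {a : ℝ} (ha : 0 < a) {f : ℝ → ℝ} (hf : Continuous f) (t p q : ℝ) :
    IntervalIntegrable (fun r => (t - r) ^ (a - 1) * f r) volume p q :=
  (ker_int ha t p q).mul_continuousOn hf.continuousOn

lemma ker_val {a : ℝ} (ha : 0 < a) (t p q : ℝ) :
    ∫ r in p..q, (t - r) ^ (a - 1) = ((t - p) ^ a - (t - q) ^ a) / a := by
  rw [intervalIntegral.integral_comp_sub_left (fun r => r ^ (a - 1)) t,
    integral_rpow (Or.inl (by linarith))]
  simp

lemma JJ_scale {a : ℝ} (ha : 0 < a) (f : ℝ → ℝ) {t : ℝ} (ht : 0 ≤ t) :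
    JJ a f t = t ^ a * ∫ r in (0:ℝ)..1, (1 - r) ^ (a - 1) * f (t * r) := by
  rcases ht.eq_or_lt with rfl | ht
  · simp [JJ, Real.zero_rpow ha.ne']
  · have h := intervalIntegral.mul_integral_comp_mul_left (a := 0) (b := 1)
      (f := fun r => (t - r) ^ (a - 1) * f r) t
    simp only [mul_zero, mul_one] at h
    rw [JJ, ← h]
    have : t ^ a = t * t ^ (a - 1) := by
      rw [Real.rpow_sub_one ht.ne']; field_simp
    rw [this, mul_assoc]
    congr 1
    rw [← intervalIntegral.integral_const_mul]
    apply intervalIntegral.integral_congr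
    intro r hr
    rw [uIcc_of_le zero_le_one] at hr
    simp only
    rw [show t - t * r = t * (1 - r) by ring, Real.mul_rpow ht.le (by linarith [hr.2])]
    ring

lemma JJ_cont {a : ℝ} (ha : 0 < a) {f : ℝ → ℝ} (hf : Continuous f) :
    Continuous (fun t => JJ a f (max t 0)) := by
  have h1 : Continuous fun t : ℝ => ∫ r in (0:ℝ)..1, (1 - r) ^ (a - 1) * f (t * r) := by
    rw [continuous_iff_continuousAt]
    intro t
    obtain ⟨M, hM⟩ := (isCompact_Icc (a := -(|t| + 1)) (b := |t| + 1)).exists_bound_of_continuousOn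
      hf.continuousOn
    apply intervalIntegral.continuousAt_of_dominated_interval
      (bound := fun r => (1 - r) ^ (a - 1) * M)
    · refine Filter.Eventually.of_forall fun s => ?_
      exact (IntervalIntegrable.def' (ker_mul_int ha (f := fun r => f (s * r)) (by fun_prop) 1 0 1)).aestronglyMeasurable
    · filter_upwards [Metric.ball_mem_nhds t one_pos] with s hs
      refine Filter.Eventually.of_forall fun r hr => ?_
      rw [uIoc_of_le zero_le_one] at hr
      have h0 : 0 ≤ (1 - r) ^ (a - 1) := Real.rpow_nonneg (by linarith [hr.2]) _
      rw [norm_mul, Real.norm_of_nonneg h0]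
      apply mul_le_mul_of_nonneg_left _ h0
      apply hM
      rw [Metric.mem_ball, Real.dist_eq] at hs
      have : |s| ≤ |t| + 1 := by
        have := abs_sub_abs_le_abs_sub s t
        linarith
      have h2 : |s * r| ≤ |t| + 1 := by
        rw [abs_mul, abs_of_pos hr.1]
        nlinarith [abs_nonneg s, hr.1, hr.2]
      exact abs_le.mp h2
    · exact (ker_int ha 1 0 1).mul_const M
    · refine Filter.Eventually.of_forall fun r _ => ?_
      have : Continuous fun x => (1 - r) ^ (a - 1) * f (x * r) := by fun_prop
      exact this.continuousAt
  have h2 : (fun t => JJ a f (max t 0)) = fun t => (max t 0) ^ a *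
      ∫ r in (0:ℝ)..1, (1 - r) ^ (a - 1) * f (max t 0 * r) := by
    ext t
    exact JJ_scale ha f (le_max_right _ _)
  rw [h2]
  have h3 : Continuous fun t : ℝ => max t 0 := by fun_prop
  exact (h3.rpow_const (fun _ => Or.inr ha.le)).mul (h1.comp h3)

lemma JJ_congr {a : ℝ} {f g : ℝ → ℝ} {t : ℝ} (ht : 0 ≤ t) (h : ∀ r, 0 ≤ r → f r = g r) :
    JJ a f t = JJ a g t := by
  apply intervalIntegral.integral_congr
  intro r hr
  rw [uIcc_of_le ht] at hr
  simp only [h r hr.1]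

lemma kap_symm (a b : ℝ) : kap a b = kap b a := by
  have h := intervalIntegral.integral_comp_sub_left (a := 0) (b := 1)
    (fun r : ℝ => (1 - r) ^ (b - 1) * r ^ (a - 1)) 1
  simp only [sub_self, sub_zero, sub_sub_cancel] at h
  rw [kap, kap, ← h]
  congr 1; ext r; ring

lemma kap_scale (a b : ℝ) {r t : ℝ} (h : r < t) :
    ∫ s in r..t, (t - s) ^ (a - 1) * (s - r) ^ (b - 1) = (t - r) ^ (a + b - 1) * kap a b := by
  have h1 := intervalIntegral.smul_integral_comp_mul_add (a := 0) (b := 1)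
      (fun s => (t - s) ^ (a - 1) * (s - r) ^ (b - 1)) (t - r) r
  simp only [mul_zero, mul_one, zero_add, sub_add_cancel, smul_eq_mul] at h1
  have hp : 0 < t - r := by linarith
  have h2 : (t - r) ^ (a + b - 1) = (t - r) * ((t - r) ^ (a - 1) * (t - r) ^ (b - 1)) := by
    rw [← Real.rpow_add hp, show a + b - 1 = 1 + (a - 1 + (b - 1)) by ring, Real.rpow_add hp,
      Real.rpow_one]
  rw [← h1, h2, mul_assoc, kap]
  congr 1
  rw [← intervalIntegral.integral_const_mul]
  apply intervalIntegral.integral_congr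
  intro s hs
  rw [uIcc_of_le zero_le_one] at hs
  simp only
  rw [show t - ((t - r) * s + r) = (t - r) * (1 - s) by ring, 
    show (t - r) * s + r - r = (t - r) * s by ring,
    Real.mul_rpow hp.le (by linarith [hs.2]), Real.mul_rpow hp.le hs.1]
  ring

lemma JJ_semi {a b : ℝ} (ha : 0 < a) (hb : 0 < b) {f : ℝ → ℝ} (hf : Continuous f) {t : ℝ}
    (ht : 0 ≤ t) : JJ a (JJ b f) t = kap a b * JJ (a + b) f t := by
  let Φ : ℝ → ℝ → ℝ := fun s r =>
    (Iio s).indicator (fun r => (t - s) ^ (a - 1) * ((s - r) ^ (b - 1) * f r)) r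
  have hind : ∀ (s : ℝ) (g : ℝ → ℝ), s ∈ Ioc 0 t →
      ∫ r in Ioc 0 t, (Iio s).indicator g r = ∫ r in (0:ℝ)..s, g r := by
    intro s g hs
    rw [setIntegral_indicator measurableSet_Iio, intervalIntegral.integral_of_le hs.1.le,
      integral_Ioc_eq_integral_Ioo]
    congr 2
    ext r; simp only [mem_inter_iff, mem_Ioc, mem_Iio, mem_Ioo] at *
    constructor
    · rintro ⟨⟨h1, h2⟩, h3⟩; exact ⟨h1, h3⟩
    · rintro ⟨h1, h2⟩; exact ⟨⟨h1, by linarith⟩, h2⟩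
  have hnorm : ∀ s r, s ∈ Ioc 0 t → ‖Φ s r‖ =
      (Iio s).indicator (fun r => (t - s) ^ (a - 1) * ((s - r) ^ (b - 1) * |f r|)) r := by
    intro s r hs
    by_cases hr : r ∈ Iio s
    · simp only [Φ, indicator_of_mem hr]
      rw [norm_mul, norm_mul, Real.norm_of_nonneg (Real.rpow_nonneg (by linarith [hs.2]) _),
        Real.norm_of_nonneg (Real.rpow_nonneg (by linarith [mem_Iio.mp hr]) _), Real.norm_eq_abs]
    · simp only [Φ, indicator_of_notMem hr, norm_zero]
  have hmeas : Measurable (Function.uncurry Φ) := by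
    have : Function.uncurry Φ = ({p : ℝ × ℝ | p.2 < p.1}).indicator
        (fun p => (t - p.1) ^ (a - 1) * ((p.1 - p.2) ^ (b - 1) * f p.2)) := by
      ext ⟨s, r⟩
      simp [Function.uncurry, Φ, indicator]
    rw [this]
    apply Measurable.indicator
    · have := hf.measurable
      fun_prop
    · exact measurableSet_lt measurable_snd measurable_fst
  have hint : Integrable (Function.uncurry Φ)
      ((volume.restrict (Ioc 0 t)).prod (volume.restrict (Ioc 0 t))) := by
    rw [integrable_prod_iff hmeas.aestronglyMeasurable]
    constructor
    · filter_upwards [ae_restrict_mem measurableSet_Ioc] with s hs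
      simp only [Function.uncurry]
      apply IntegrableOn.integrable_indicator _ measurableSet_Iio
      exact Integrable.integrableOn (((ker_mul_int hb hf s 0 t).const_mul ((t - s) ^ (a - 1))).1)
    · have h1 : ∀ s ∈ Ioc 0 t, ∫ r in Ioc 0 t, ‖Function.uncurry Φ (s, r)‖ =
          (t - s) ^ (a - 1) * JJ b (fun r => |f r|) (max s 0) := by
        intro s hs
        simp only [Function.uncurry, hnorm s _ hs]
        rw [hind s _ hs, intervalIntegral.integral_const_mul, max_eq_left hs.1.le, JJ]
      have h2 := (ker_mul_int ha (JJ_cont hb hf.abs) t 0 t).1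
      exact h2.congr (by
        filter_upwards [ae_restrict_mem measurableSet_Ioc] with s hs
        rw [h1 s hs])
  have hsw := integral_integral_swap hint
  have hL : ∫ s in Ioc 0 t, ∫ r in Ioc 0 t, Φ s r = JJ a (JJ b f) t := by
    rw [JJ, intervalIntegral.integral_of_le ht]
    apply setIntegral_congr_fun measurableSet_Ioc
    intro s hs
    simp only [Φ]
    rw [hind s _ hs, intervalIntegral.integral_const_mul, JJ]
  have hR : ∫ r in Ioc 0 t, ∫ s in Ioc 0 t, Φ s r = kap a b * JJ (a + b) f t := by
    rw [JJ, ← intervalIntegral.integral_const_mul, intervalIntegral.integral_of_le ht,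
      integral_Ioc_eq_integral_Ioo, integral_Ioc_eq_integral_Ioo]
    apply setIntegral_congr_fun measurableSet_Ioo
    intro r hr
    simp only
    have e : ∀ s, Φ s r = (Ioi r).indicator (fun s => 
        ((t - s) ^ (a - 1) * (s - r) ^ (b - 1)) * f r) s := by
      intro s
      simp only [Φ, indicator, mem_Iio, mem_Ioi, mul_assoc]
    simp only [e]
    rw [setIntegral_indicator measurableSet_Ioi]
    have : Ioc 0 t ∩ Ioi r = Ioc r t := by
      ext s; simp only [mem_inter_iff, mem_Ioc, mem_Ioi, mem_Ioo] at *
      constructor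
      · rintro ⟨⟨h1, h2⟩, h3⟩; exact ⟨h3, h2⟩
      · rintro ⟨h1, h2⟩; exact ⟨⟨by linarith, h2⟩, h1⟩
    rw [this, ← intervalIntegral.integral_of_le hr.2.le, intervalIntegral.integral_mul_const,
      kap_scale a b hr.2]
    ring
  rw [← hL, ← hR]
  exact hsw

lemma kap_pos {a b : ℝ} (ha : 0 < a) (hb : 0 < b) : 0 < kap a b := by
  have h := JJ_semi ha hb (f := fun _ => 1) continuous_const (t := 1) zero_le_one
  have hJ : ∀ {c : ℝ}, 0 < c → ∀ s, 0 ≤ s → JJ c (fun _ => 1) s = s ^ c / c := by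
    intro c hc s hs
    simp [JJ, ker_val hc, Real.zero_rpow hc.ne']
  have h1 : 0 < JJ a (JJ b fun _ => 1) 1 := by
    rw [JJ_congr zero_le_one (g := fun s => (max s 0) ^ b / b)]
    · apply intervalIntegral.intervalIntegral_pos_of_pos_on
      · apply ker_mul_int ha
        have h3 : Continuous fun t : ℝ => max t 0 := by fun_prop
        exact (h3.rpow_const (fun _ => Or.inr hb.le)).div_const _
      · intro r hr
        have h1 := Real.rpow_pos_of_pos (sub_pos.mpr hr.2) (a - 1)
        have h2 := Real.rpow_pos_of_pos (lt_max_of_lt_left (c := 0) hr.1) b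
        positivity
      · exact one_pos
    · intro r hr
      rw [hJ hb r hr, max_eq_left hr]
  rw [h, hJ (by linarith) 1 zero_le_one] at h1
  have : 0 < (1:ℝ) ^ (a + b) / (a + b) := by
    have := Real.rpow_pos_of_pos one_pos (a + b)
    positivity
  exact pos_of_mul_pos_left h1 this.le

lemma JJ_const_mul (a c : ℝ) (f : ℝ → ℝ) (t : ℝ) : JJ a (fun r => c * f r) t = c * JJ a f t := by
  rw [JJ, JJ, ← intervalIntegral.integral_const_mul]
  congr 1; ext r; ring

lemma JJ_one (f : ℝ → ℝ) (t : ℝ) : JJ 1 f t = ∫ r in (0:ℝ)..t, f r := by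
  simp [JJ]

lemma JJ_add_const {a : ℝ} (ha : 0 < a) {f : ℝ → ℝ} (hf : Continuous f) (k : ℝ) {t : ℝ} :
    JJ a (fun r => f r + k) t = JJ a f t + k * ((t ^ a - 0 ^ a) / a) := by
  have h : (fun r => (t - r) ^ (a - 1) * (f r + k)) =
      fun r => (t - r) ^ (a - 1) * f r + (t - r) ^ (a - 1) * k := by ext r; ring
  rw [JJ, h, intervalIntegral.integral_add (ker_mul_int ha hf t 0 t)
    ((ker_int ha t 0 t).mul_const k), intervalIntegral.integral_mul_const, ker_val ha, JJ]
  simp; ring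

lemma inversion {α : ℝ} (hα : α ∈ Ioo (0:ℝ) 1) {x F : ℝ → ℝ} (hx : Continuous x)
    (hF : Continuous F) (c : ℝ)
    (hK : ∀ t > 0, HasDerivAt (fun t => c * JJ (1 - α) (fun r => x r - x 0) t) (F t) t) :
    ∀ t > 0, c * kap α (1 - α) * (x t - x 0) = JJ α F t := by
  have h1a : 0 < 1 - α := by linarith [hα.2]
  have hxc : Continuous fun r => x r - x 0 := by fun_prop
  have hKF : ∀ t ≥ 0, c * JJ (1 - α) (fun r => x r - x 0) t = JJ 1 F t := by
    intro t ht
    rw [JJ_one, intervalIntegral.integral_eq_sub_of_hasDerivAt_of_le ht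
      (f := fun t => c * JJ (1 - α) (fun r => x r - x 0) t) (f' := F)]
    · simp [JJ]
    · have := ((JJ_cont h1a hxc).const_mul c).continuousOn (s := Icc 0 t)
      apply this.congr
      intro s hs
      simp only [max_eq_left hs.1]
    · intro s hs; exact hK s hs.1
    · exact hF.intervalIntegrable _ _
  have hcJ : Continuous fun t => JJ α F (max t 0) := JJ_cont hα.1 hF
  have hI : ∀ t ≥ 0, ∫ r in (0:ℝ)..t, (c * kap α (1 - α) * (x r - x 0)) =
      ∫ r in (0:ℝ)..t, JJ α F (max r 0) := by
    intro t ht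
    have e1 : JJ α (fun t => c * JJ (1 - α) (fun r => x r - x 0) t) t = JJ α (JJ 1 F) t :=
      JJ_congr ht hKF
    rw [JJ_const_mul, JJ_semi hα.1 h1a hxc ht, JJ_semi hα.1 one_pos hF ht, kap_symm α 1,
      add_comm α 1, ← JJ_semi one_pos hα.1 hF ht, add_sub_cancel, JJ_one, JJ_one] at e1
    rw [intervalIntegral.integral_const_mul, mul_assoc, e1]
    apply intervalIntegral.integral_congr
    intro r hr
    rw [uIcc_of_le ht] at hr
    simp only [max_eq_left hr.1]
  intro t ht
  have d1 := (show Continuous fun r => c * kap α (1 - α) * (x r - x 0) by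
    fun_prop).integral_hasStrictDerivAt 0 t |>.hasDerivAt
  have d2 := hcJ.integral_hasStrictDerivAt 0 t |>.hasDerivAt
  have d3 := d1.congr_of_eventuallyEq (f₁ := fun t => ∫ r in (0:ℝ)..t, JJ α F (max r 0)) (by
    filter_upwards [lt_mem_nhds ht] with s hs
    exact (hI s hs.le).symm)
  have := d3.unique d2
  rwa [max_eq_left ht.le] at this

lemma pow_diff {α : ℝ} (hα : α ∈ Ioo (0:ℝ) 1) {p h : ℝ} (hp : 0 < p) (h0 : 0 ≤ h) (hh : h ≤ p) :
    p ^ α - (p - h) ^ α ≤ p ^ (α - 1) * h := by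
  have hy : 0 ≤ 1 - h / p := by
    have : h / p ≤ 1 := (div_le_one hp).mpr hh
    linarith
  have hy1 : 1 - h / p ≤ 1 := by
    have : 0 ≤ h / p := by positivity
    linarith
  have h1 : 1 - h / p ≤ (1 - h / p) ^ α := by
    rcases hy.eq_or_lt with h2 | h2
    · rw [← h2, Real.zero_rpow hα.1.ne']
    · have := Real.rpow_le_rpow_of_exponent_ge h2 hy1 hα.2.le
      rwa [Real.rpow_one] at this
  have h2 : (p - h) ^ α = p ^ α * (1 - h / p) ^ α := by
    rw [← Real.mul_rpow hp.le hy]; congr 1; field_simp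
  have h3 : p ^ (α - 1) * h = p ^ α * (h / p) := by
    rw [Real.rpow_sub_one hp.ne']; field_simp
  rw [h2, h3]
  nlinarith [Real.rpow_pos_of_pos hp α]

lemma small_ev {α : ℝ} (hα : α ∈ Ioo (0:ℝ) 1) (K : ℝ) {ε : ℝ} (hε : 0 < ε) :
    ∀ᶠ h in nhdsWithin (0:ℝ) (Ioi 0), K * h ≤ ε * h ^ α := by
  have hc : Filter.Tendsto (fun h : ℝ => K * h ^ (1 - α)) (nhdsWithin (0:ℝ) (Ioi 0)) (nhds 0) := by
    have : ContinuousAt (fun h : ℝ => K * h ^ (1 - α)) 0 :=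
      (Real.continuousAt_rpow_const 0 (1 - α) (Or.inr (by linarith [hα.2]))).const_mul K
    have h2 := this.tendsto
    rw [Real.zero_rpow (by linarith [hα.2]), mul_zero] at h2
    exact h2.mono_left nhdsWithin_le_nhds
  filter_upwards [hc.eventually (gt_mem_nhds hε), self_mem_nhdsWithin] with h h1 h2
  have h3 : h = h ^ (1 - α) * h ^ α := by
    rw [← Real.rpow_add h2]; simp
  have h4 := Real.rpow_pos_of_pos h2 α
  calc K * h = K * h ^ (1 - α) * h ^ α := by rw [mul_assoc, ← h3]
    _ ≤ _ := by nlinarith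

lemma ker_anti {a : ℝ} (ha : a ≤ 1) {t h r : ℝ} (hh : 0 ≤ h) (hr : r < t - h) :
    (t - r) ^ (a - 1) ≤ (t - h - r) ^ (a - 1) :=
  Real.rpow_le_rpow_of_nonpos (by linarith) (by linarith) (by linarith)

/-- splitting of a difference of `JJ` -/
lemma JJ_diff {a : ℝ} (ha : 0 < a) {f : ℝ → ℝ} (hf : Continuous f) (t h b : ℝ) :
    JJ a f t - JJ a f (t - h) =
      (∫ r in (0:ℝ)..b, ((t - r) ^ (a - 1) - (t - h - r) ^ (a - 1)) * f r) +
      (∫ r in b..(t - h), ((t - r) ^ (a - 1) - (t - h - r) ^ (a - 1)) * f r) +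
      ∫ r in (t - h)..t, (t - r) ^ (a - 1) * f r := by
  have e : ∀ r, ((t - r) ^ (a - 1) - (t - h - r) ^ (a - 1)) * f r =
    (t - r) ^ (a - 1) * f r - (t - h - r) ^ (a - 1) * f r := fun r => by ring
  simp only [e]
  have i1 := ker_mul_int ha hf t
  have i2 := ker_mul_int ha hf (t - h)
  rw [intervalIntegral.integral_sub (i1 _ _) (i2 _ _),
    intervalIntegral.integral_sub (i1 _ _) (i2 _ _), JJ, JJ,
    ← intervalIntegral.integral_add_adjacent_intervals (i1 0 b) (i1 b t),
    ← intervalIntegral.integral_add_adjacent_intervals (i1 b (t - h)) (i1 (t - h) t),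
    ← intervalIntegral.integral_add_adjacent_intervals (i2 0 b) (i2 b (t - h))]
  ring

lemma kd_int {a : ℝ} (ha : 0 < a) {f : ℝ → ℝ} (hf : Continuous f) (t h p q : ℝ) :
    IntervalIntegrable (fun r => ((t - r) ^ (a - 1) - (t - h - r) ^ (a - 1)) * f r) volume p q :=
  ((ker_int ha t p q).sub (ker_int ha (t - h) p q)).mul_continuousOn hf.continuousOn

lemma kd_val {a : ℝ} (ha : 0 < a) (t h p q M : ℝ) :
    ∫ r in p..q, ((t - r) ^ (a - 1) - (t - h - r) ^ (a - 1)) * M =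
      (((t - p) ^ a - (t - q) ^ a) / a - ((t - h - p) ^ a - (t - h - q) ^ a) / a) * M := by
  rw [intervalIntegral.integral_mul_const,
    intervalIntegral.integral_sub (ker_int ha t p q) (ker_int ha (t - h) p q),
    ker_val ha, ker_val ha]

/-- upper bound of the integral against the (nonpositive) kernel difference -/
lemma kd_le {a : ℝ} (ha : 0 < a) (ha1 : a ≤ 1) {f : ℝ → ℝ} (hf : Continuous f) {t h p q M : ℝ}
    (hh : 0 ≤ h) (hpq : p ≤ q) (hq : q ≤ t - h) (hM : ∀ r ∈ Icc p q, M ≤ f r) :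
    ∫ r in p..q, ((t - r) ^ (a - 1) - (t - h - r) ^ (a - 1)) * f r ≤
      (((t - p) ^ a - (t - q) ^ a) / a - ((t - h - p) ^ a - (t - h - q) ^ a) / a) * M := by
  rw [← kd_val ha]
  apply intervalIntegral.integral_mono_on_of_le_Ioo hpq (kd_int ha hf t h p q)
    (kd_int ha continuous_const t h p q)
  intro r hr
  have h1 := ker_anti ha1 hh (lt_of_lt_of_le hr.2 hq)
  have h2 := hM r (Ioo_subset_Icc_self hr)
  nlinarith

lemma little_holder {α : ℝ} (hα : α ∈ Ioo (0:ℝ) 1) {F : ℝ → ℝ} (hF : Continuous F) {t : ℝ}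
    (ht : 0 < t) {ε : ℝ} (hε : 0 < ε) :
    ∀ᶠ h in nhdsWithin (0:ℝ) (Ioi 0), JJ α F (t - h) - JJ α F t ≤ ε * h ^ α := by
  have ha := hα.1
  set f : ℝ → ℝ := fun r => -(F r - F t) with hfdef
  have hf : Continuous f := by fun_prop
  set ε' := α * ε / 4 with hε'
  have hε'0 : 0 < ε' := by positivity
  obtain ⟨δ₀, hδ₀, hδ⟩ := Metric.continuousAt_iff.mp (hf.continuousAt (x := t)) ε' hε'0
  set δ := min (δ₀ / 2) (t / 2) with hδdef
  have hδ0 : 0 < δ := by positivity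
  have hδt : δ < t := by
    have := min_le_right (δ₀ / 2) (t / 2); linarith
  have hδδ : δ < δ₀ := by
    have := min_le_left (δ₀ / 2) (t / 2); linarith
  have hsm : ∀ r ∈ Icc (t - δ) t, |f r| ≤ ε' := by
    intro r hr
    have := hδ (x := r) (by
      rw [Real.dist_eq, abs_lt]; constructor <;> linarith [hr.1, hr.2])
    simp only [hfdef, Real.dist_eq, sub_self, neg_zero, sub_zero] at this
    exact this.le
  obtain ⟨M, hM⟩ := (isCompact_Icc (a := 0) (b := t)).exists_bound_of_continuousOn
      hf.continuousOn
  have hM0 : 0 ≤ M := (norm_nonneg _).trans (hM 0 ⟨le_rfl, ht.le⟩)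
  filter_upwards [small_ev hα (M * δ ^ (α - 1) / α + |F t| * t ^ (α - 1) / α)
    (half_pos hε), self_mem_nhdsWithin, nhdsWithin_le_nhds (gt_mem_nhds hδ0)] with h hsmall h0 hhδ
  replace h0 : 0 < h := h0
  have eF : F = fun r => -1 * f r + F t := by ext r; simp [hfdef]
  have eJ : ∀ s, JJ α F s = - JJ α f s + F t * ((s ^ α - 0 ^ α) / α) := by
    intro s
    conv_lhs => rw [eF]
    rw [JJ_add_const ha (by fun_prop), JJ_const_mul]; ring
  have hd := JJ_diff ha hf t h (t - δ)
  have k1 := kd_le ha hα.2.le hf (t := t) (h := h) (p := 0) (q := t - δ) (M := -M) h0.le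
    (by linarith) (by linarith) (fun r hr => (abs_le.mp (hM r ⟨hr.1, by linarith [hr.2]⟩)).1)
  have k2 := kd_le ha hα.2.le hf (t := t) (h := h) (p := t - δ) (q := t - h) (M := -ε') h0.le
    (by linarith) (by linarith) (fun r hr => (abs_le.mp (hsm r ⟨hr.1, by linarith [hr.2]⟩)).1)
  have k3 : ∫ r in (t - h)..t, (t - r) ^ (α - 1) * f r ≤ h ^ α / α * ε' := by
    have : ∫ r in (t - h)..t, (t - r) ^ (α - 1) * ε' = h ^ α / α * ε' := by
      rw [intervalIntegral.integral_mul_const, ker_val ha]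
      simp [Real.zero_rpow ha.ne']
    rw [← this]
    apply intervalIntegral.integral_mono_on (by linarith) (ker_mul_int ha hf _ _ _)
      ((ker_int ha _ _ _).mul_const _)
    intro r hr
    exact mul_le_mul_of_nonneg_left (abs_le.mp (hsm r ⟨by linarith [hr.1], hr.2⟩)).2
      (Real.rpow_nonneg (by linarith [hr.2]) _)
  have p1 := pow_diff hα hδ0 h0.le hhδ.le
  have p2 := pow_diff hα ht h0.le (by linarith)
  have m1 : (t - h) ^ α ≤ t ^ α := Real.rpow_le_rpow (by linarith) (by linarith) ha.le
  have m2 : (δ - h) ^ α ≤ δ ^ α := Real.rpow_le_rpow (by linarith) (by linarith) ha.le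
  have z : (0:ℝ) ^ α = 0 := Real.zero_rpow ha.ne'
  rw [show t - (t - δ) = δ by ring, show t - h - (t - δ) = δ - h by ring] at k1 k2
  rw [show t - (t - h) = h by ring, show t - h - (t - h) = 0 by ring, z] at k2
  simp only [sub_zero] at k1 k2
  have b1 : ((t ^ α - δ ^ α) / α - ((t - h) ^ α - (δ - h) ^ α) / α) * (-M) ≤
      M * δ ^ (α - 1) / α * h := by
    have : M * δ ^ (α - 1) / α * h - ((t ^ α - δ ^ α) / α - ((t - h) ^ α - (δ - h) ^ α) / α) * (-M)
      = M / α * (δ ^ (α - 1) * h - (δ ^ α - (δ - h) ^ α) + (t ^ α - (t - h) ^ α)) := by ring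
    have h2 : 0 ≤ M / α * (δ ^ (α - 1) * h - (δ ^ α - (δ - h) ^ α) + (t ^ α - (t - h) ^ α)) :=
      mul_nonneg (by positivity) (by linarith)
    linarith
  have b2 : ((δ ^ α - h ^ α) / α - (δ - h) ^ α / α) * (-ε') ≤ h ^ α / α * ε' := by
    have : h ^ α / α * ε' - ((δ ^ α - h ^ α) / α - (δ - h) ^ α / α) * (-ε') =
      ε' / α * (δ ^ α - (δ - h) ^ α) := by ring
    have h2 : 0 ≤ ε' / α * (δ ^ α - (δ - h) ^ α) := mul_nonneg (by positivity) (by linarith)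
    linarith
  have b3 : F t * (((t - h) ^ α) / α) - F t * ((t ^ α) / α) ≤ |F t| * t ^ (α - 1) / α * h := by
    have e : F t * (((t - h) ^ α) / α) - F t * ((t ^ α) / α) =
      - F t * ((t ^ α - (t - h) ^ α) / α) := by ring
    rw [e]
    calc - F t * ((t ^ α - (t - h) ^ α) / α) ≤ |F t| * ((t ^ α - (t - h) ^ α) / α) :=
          mul_le_mul_of_nonneg_right (neg_le_abs _) (div_nonneg (by linarith) ha.le)
      _ ≤ |F t| * ((t ^ (α - 1) * h) / α) := by gcongr
      _ = _ := by ring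
  have e4 : h ^ α / α * ε' = ε / 4 * h ^ α := by rw [hε']; field_simp
  rw [eJ, eJ, z]
  simp only [sub_zero]
  linarith

lemma extremum {α : ℝ} (hα : α ∈ Ioo (0:ℝ) 1) {x F : ℝ → ℝ} (hx : Continuous x)
    (hF : Continuous F) {c : ℝ} (hc : 0 < c)
    (hK : ∀ t > 0, HasDerivAt (fun t => c * JJ (1 - α) (fun r => x r - x 0) t) (F t) t)
    {t b m : ℝ} (hb : 0 ≤ b) (hbt : b < t) (hm : 0 ≤ m) (h1 : ∀ r ∈ Icc 0 t, x t ≤ x r)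
    (h2 : ∀ r ∈ Icc 0 b, x t + m ≤ x r) : F t ≤ - (c * m * (t - b) ^ (-α)) := by
  have ht : 0 < t := by linarith
  have h1a : 0 < 1 - α := by linarith [hα.2]
  have hκ := kap_pos hα.1 h1a
  set u : ℝ → ℝ := fun r => x r - x t with hu
  have huc : Continuous u := by fun_prop
  have hxu : (fun r => x r - x 0) = fun r => u r + (-u 0) := by
    ext r; simp only [hu]; ring
  have hpd : ∀ s : ℝ, 0 < s → HasDerivAt (fun s : ℝ => s ^ (1 - α) / (1 - α)) (s ^ (-α)) s := by
    intro s hs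
    have := (Real.hasDerivAt_rpow_const (x := s) (p := 1 - α) (Or.inl hs.ne')).div_const (1 - α)
    refine this.congr_deriv ?_
    rw [show 1 - α - 1 = -α by ring]; field_simp
  have z : (0:ℝ) ^ (1 - α) = 0 := Real.zero_rpow h1a.ne'
  have hP : HasDerivAt (JJ (1 - α) u) (F t / c + u 0 * t ^ (-α)) t := by
    have := ((hK t ht).div_const c).add ((hpd t ht).const_mul (u 0))
    refine this.congr_of_eventuallyEq (Filter.Eventually.of_forall fun s => ?_)
    simp only [Pi.add_apply]
    rw [hxu, JJ_add_const h1a huc, z]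
    field_simp
    ring
  have hR : HasDerivAt (fun s => m * (s ^ (1 - α) / (1 - α) - (s - b) ^ (1 - α) / (1 - α)))
      (m * (t ^ (-α) - (t - b) ^ (-α))) t := by
    have h3 := (hpd (t - b) (by linarith)).comp_sub_const t b
    exact ((hpd t ht).sub h3).const_mul m
  have hQ := hP.sub hR
  have hq : F t / c + u 0 * t ^ (-α) - m * (t ^ (-α) - (t - b) ^ (-α)) ≤ 0 := by
    apply le_of_forall_pos_le_add
    intro ε hε
    rw [zero_add]
    have hQ' := (hQ.scomp_of_eq (x := 0) (h := fun h : ℝ => t - h) (h' := -1) (by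
      simpa using (hasDerivAt_id (0:ℝ)).const_sub t) (by simp)).tendsto_slope_zero_right
    have hQ2 := hQ'.neg
    refine le_of_tendsto (a := F t / c + u 0 * t ^ (-α) - m * (t ^ (-α) - (t - b) ^ (-α)))
      (by simpa using hQ2) ?_
    have hck : 0 < c * kap α (1 - α) := by positivity
    have hl := little_holder hα hF ht (mul_pos hck hε)
    obtain ⟨δ, hδ0, hδ⟩ := (mem_nhdsGT_iff_exists_Ioo_subset).mp hl
    replace hδ0 : 0 < δ := hδ0
    have hux : ∀ s, 0 < s → s < δ → s < t → u (t - s) ≤ ε * s ^ α := by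
      intro s hs hsδ hst
      have h3 := hδ ⟨hs, hsδ⟩
      change JJ α F (t - s) - JJ α F t ≤ _ at h3
      rw [← inversion hα hx hF c hK t ht, ← inversion hα hx hF c hK (t - s) (by linarith)] at h3
      have h4 : c * kap α (1 - α) * u (t - s) ≤ c * kap α (1 - α) * (ε * s ^ α) := by
        simp only [hu]; linarith
      exact le_of_mul_le_mul_left h4 hck
    filter_upwards [self_mem_nhdsWithin, nhdsWithin_le_nhds (gt_mem_nhds hδ0),
      nhdsWithin_le_nhds (gt_mem_nhds (sub_pos.mpr hbt))] with h h0 hhδ hhb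
    replace h0 : 0 < h := h0
    have hd := JJ_diff h1a huc t h b
    have k1 := kd_le h1a (by linarith [hα.1]) huc (t := t) (h := h) (p := 0) (q := b) (M := m)
      h0.le hb (by linarith) (fun r hr => by simp only [hu]; linarith [h2 r hr])
    have k2 := kd_le h1a (by linarith [hα.1]) huc (t := t) (h := h) (p := b) (q := t - h) (M := 0)
      h0.le (by linarith) le_rfl (fun r hr => by
        simp only [hu]; linarith [h1 r ⟨by linarith [hr.1], by linarith [hr.2]⟩])
    have k3 : ∫ r in (t - h)..t, (t - r) ^ (1 - α - 1) * u r ≤ ε * h := by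
      have : ∫ r in (t - h)..t, ε = ε * h := by simp; ring
      rw [← this]
      apply intervalIntegral.integral_mono_on_of_le_Ioo (by linarith) (ker_mul_int h1a huc _ _ _)
        (by simp)
      intro r hr
      have hp : 0 < t - r := by linarith [hr.2]
      have h5 := hux (t - r) hp (by linarith [hr.1]) (by linarith [hr.1])
      rw [sub_sub_cancel] at h5
      calc _ ≤ (t - r) ^ (1 - α - 1) * (ε * (t - r) ^ α) :=
            mul_le_mul_of_nonneg_left h5 (Real.rpow_nonneg hp.le _)
        _ = ε * ((t - r) ^ (1 - α - 1) * (t - r) ^ α) := by ring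
        _ = ε := by rw [← Real.rpow_add hp]; simp
    simp only [sub_zero] at k1
    have hfin : (JJ (1 - α) u t - m * (t ^ (1 - α) / (1 - α) - (t - b) ^ (1 - α) / (1 - α))) -
        (JJ (1 - α) u (t - h) - m * ((t - h) ^ (1 - α) / (1 - α) - (t - h - b) ^ (1 - α) / (1 - α)))
        ≤ ε * h := by
      have : (((t) ^ (1 - α) - (t - b) ^ (1 - α)) / (1 - α) -
        ((t - h) ^ (1 - α) - (t - h - b) ^ (1 - α)) / (1 - α)) * m =
        m * (t ^ (1 - α) / (1 - α) - (t - b) ^ (1 - α) / (1 - α)) -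
        m * ((t - h) ^ (1 - α) / (1 - α) - (t - h - b) ^ (1 - α) / (1 - α)) := by ring
      linarith
    rw [← mul_neg, inv_mul_le_iff₀ h0]
    linarith
  have hu0 : m ≤ u 0 := by simp only [hu]; linarith [h2 0 ⟨le_rfl, hb⟩]
  have htp := Real.rpow_pos_of_pos ht (-α)
  have h6 : F t / c ≤ - (m * (t - b) ^ (-α)) := by nlinarith
  rw [div_le_iff₀ hc] at h6
  linarith

/-- Positivity of coupled fractional delay systems: Metzler `A` and nonnegative
`B, E, C, D` with nonnegative initial data yield nonnegative solutions. -/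
theorem coupled_system_positivity (d' n' : ℕ) (α τ₁ τ₂ τ₃ τ : ℝ)
    (hα : α ∈ Set.Ioo (0:ℝ) 1) (hτ₁ : 0 < τ₁) (hτ₂ : 0 < τ₂) (hτ₃ : 0 < τ₃)
    (hτ : τ = max (max τ₁ τ₂) τ₃)
    (A B : Matrix (Fin d') (Fin d') ℝ) (E : Matrix (Fin d') (Fin n') ℝ)
    (C : Matrix (Fin n') (Fin d') ℝ) (D : Matrix (Fin n') (Fin n') ℝ)
    (x φ : ℝ → Fin d' → ℝ) (y ψ : ℝ → Fin n' → ℝ)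
    (hx : ContinuousOn x (Set.Ici (-τ))) (hy : ContinuousOn y (Set.Ici (-τ)))
    (hφ : ContinuousOn φ (Set.Icc (-τ) 0)) (hψ : ContinuousOn ψ (Set.Icc (-τ) 0))
    (hφ0 : ∀ t ∈ Set.Icc (-τ) 0, ∀ i, 0 ≤ φ t i)
    (hψ0 : ∀ t ∈ Set.Icc (-τ) 0, ∀ i, 0 ≤ ψ t i)
    (hxi : ∀ t ∈ Set.Icc (-τ) 0, x t = φ t) (hyi : ∀ t ∈ Set.Icc (-τ) 0, y t = ψ t)
    (hcompat : C.mulVec (φ 0) + D.mulVec (ψ (-τ₃)) = ψ 0)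
    (hdiff : ∀ t > 0, ∀ i, DifferentiableAt ℝ (caputoKernel α (fun s => x s i)) t)
    (hode : ∀ t > 0, ∀ i, caputo α (fun s => x s i) t =
      (A.mulVec (x t) + B.mulVec (x (t - τ₁)) + E.mulVec (y (t - τ₂))) i)
    (halg : ∀ t ≥ 0, y t = C.mulVec (x t) + D.mulVec (y (t - τ₃)))
    (hA : ∀ i j, i ≠ j → 0 ≤ A i j)
    (hB : ∀ i j, 0 ≤ B i j) (hE : ∀ i j, 0 ≤ E i j)
    (hC : ∀ i j, 0 ≤ C i j) (hD : ∀ i j, 0 ≤ D i j) :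
    ∀ t ≥ 0, (∀ i, 0 ≤ x t i) ∧ (∀ i, 0 ≤ y t i) := by
  have hα0 := hα.1
  have h1a : 0 < 1 - α := by linarith [hα.2]
  have hτ1 : τ₁ ≤ τ := by rw [hτ]; exact (le_max_left _ _).trans (le_max_left _ _)
  have hτ2 : τ₂ ≤ τ := by rw [hτ]; exact (le_max_right _ _).trans (le_max_left _ _)
  have hτ3 : τ₃ ≤ τ := by rw [hτ]; exact le_max_right _ _
  have hτ0 : 0 < τ := by linarith
  set c : ℝ := 1 / Real.Gamma (1 - α) with hc
  have hc0 : 0 < c := one_div_pos.mpr (Real.Gamma_pos_of_pos h1a)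
  have hmax : ∀ (s : ℝ), 0 ≤ s → s ≤ τ → ∀ t : ℝ, max t 0 - s ∈ Ici (-τ) := by
    intro s _ hs t
    have := le_max_right t 0
    simp only [mem_Ici]; linarith
  have hxc : ∀ s : ℝ, 0 ≤ s → s ≤ τ → Continuous fun t : ℝ => x (max t 0 - s) := by
    intro s h0 hs
    exact hx.comp_continuous (by fun_prop) (hmax s h0 hs)
  have hyc : ∀ s : ℝ, 0 ≤ s → s ≤ τ → Continuous fun t : ℝ => y (max t 0 - s) := by
    intro s h0 hs
    exact hy.comp_continuous (by fun_prop) (hmax s h0 hs)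
  have hx0c : Continuous fun t : ℝ => x (max t 0) := by
    simpa using hxc 0 le_rfl hτ0.le
  let X : Fin d' → ℝ → ℝ := fun i t => x (max t 0) i
  let F : Fin d' → ℝ → ℝ := fun i t => (A.mulVec (x (max t 0)) + B.mulVec (x (max t 0 - τ₁)) +
    E.mulVec (y (max t 0 - τ₂))) i
  have hXc : ∀ i, Continuous (X i) := fun i => (continuous_apply i).comp hx0c
  have hFc : ∀ i, Continuous (F i) := by
    intro i
    refine (continuous_apply i).comp ?_
    exact ((continuous_const.matrix_mulVec hx0c).add
      (continuous_const.matrix_mulVec (hxc τ₁ hτ₁.le hτ1))).add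
      (continuous_const.matrix_mulVec (hyc τ₂ hτ₂.le hτ2))
  have hK : ∀ i, ∀ t > 0, HasDerivAt
      (fun t => c * JJ (1 - α) (fun r => X i r - X i 0) t) (F i t) t := by
    intro i t ht
    have h1 := (hdiff t ht i).hasDerivAt
    have h2 : deriv (caputoKernel α fun s => x s i) t = F i t := by
      have := hode t ht i
      simp only [caputo] at this
      simp only [F, max_eq_left ht.le, this]
    rw [h2] at h1
    refine h1.congr_of_eventuallyEq ?_
    filter_upwards [lt_mem_nhds ht] with s hs
    rw [caputoKernel, JJ, hc]
    congr 1
    apply intervalIntegral.integral_congr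
    intro r hr
    rw [uIcc_of_le hs.le] at hr
    simp only [X, max_eq_left hr.1, max_self]
    rw [show 1 - α - 1 = -α by ring]
  set L : ℝ := ∑ i, ∑ j, |A i j| with hL
  have hL0 : 0 ≤ L := Finset.sum_nonneg fun i _ => Finset.sum_nonneg fun j _ => abs_nonneg _
  obtain ⟨η, hη0, hη1, hη2, hη3, hηL⟩ : ∃ η : ℝ, 0 < η ∧ η ≤ τ₁ ∧ η ≤ τ₂ ∧ η ≤ τ₃ ∧
      L < c * η ^ (-α) := by
    have ht : Filter.Tendsto (fun h : ℝ => L * h ^ α) (nhdsWithin (0:ℝ) (Ioi 0)) (nhds 0) := by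
      have : ContinuousAt (fun h : ℝ => L * h ^ α) 0 :=
        (Real.continuousAt_rpow_const 0 α (Or.inr hα0.le)).const_mul L
      have h2 := this.tendsto
      rw [Real.zero_rpow hα0.ne', mul_zero] at h2
      exact h2.mono_left nhdsWithin_le_nhds
    have hev : ∀ᶠ η in nhdsWithin (0:ℝ) (Ioi 0), 0 < η ∧ η ≤ τ₁ ∧ η ≤ τ₂ ∧ η ≤ τ₃ ∧
        L < c * η ^ (-α) := by
      filter_upwards [ht.eventually (gt_mem_nhds hc0), self_mem_nhdsWithin,
        nhdsWithin_le_nhds (gt_mem_nhds hτ₁), nhdsWithin_le_nhds (gt_mem_nhds hτ₂),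
        nhdsWithin_le_nhds (gt_mem_nhds hτ₃)] with η h1 h2 h3 h4 h5
      refine ⟨h2, h3.le, h4.le, h5.le, ?_⟩
      rw [Real.rpow_neg (le_of_lt h2), ← div_eq_mul_inv, lt_div_iff₀ (Real.rpow_pos_of_pos h2 α)]
      exact h1
    exact hev.exists
  have hmv : ∀ {p q : ℕ} (M : Matrix (Fin p) (Fin q) ℝ) (v : Fin q → ℝ), (∀ i j, 0 ≤ M i j) →
      (∀ j, 0 ≤ v j) → ∀ i, 0 ≤ M.mulVec v i := by
    intro p q M v hM hv i
    simp only [Matrix.mulVec, dotProduct]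
    exact Finset.sum_nonneg fun j _ => mul_nonneg (hM i j) (hv j)
  have key : ∀ k : ℕ, ∀ t, -τ ≤ t → t ≤ k * η → (∀ i, 0 ≤ x t i) ∧ (∀ i, 0 ≤ y t i) := by
    intro k
    induction k with
    | zero =>
      intro t h1 h2
      have h3 : t ∈ Icc (-τ) 0 := ⟨h1, by simpa using h2⟩
      rw [hxi t h3, hyi t h3]
      exact ⟨hφ0 t h3, hψ0 t h3⟩
    | succ k ih =>
      have hkη : 0 ≤ (k:ℝ) * η := by positivity
      have hk1 : ((k + 1 : ℕ) : ℝ) * η = k * η + η := by push_cast; ring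
      rw [hk1]
      have hxpos : ∀ t, -τ ≤ t → t ≤ k * η + η → ∀ i, 0 ≤ x t i := by
        by_contra hcon
        push Not at hcon
        obtain ⟨t₁, ht₁, ht₁', i₁, hi₁⟩ := hcon
        have ht₁0 : 0 ≤ t₁ := by
          by_contra h
          push Not at h
          have := (ih t₁ ht₁ (by linarith)).1 i₁
          linarith
        have hmin : ∀ i, ∃ t ∈ Icc 0 (k * η + η), ∀ s ∈ Icc 0 (k * η + η), X i t ≤ X i s := by
          intro i
          obtain ⟨t, ht, hm⟩ := (isCompact_Icc (a := 0) (b := k * η + η)).exists_isMinOn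
            ⟨0, le_rfl, by linarith⟩ (hXc i).continuousOn
          exact ⟨t, ht, fun s hs => hm hs⟩
        choose T hT hTm using hmin
        have : Nonempty (Fin d') := ⟨i₁⟩
        obtain ⟨i, hi⟩ := Finite.exists_min (fun i => X i (T i))
        have hall : ∀ j, ∀ s ∈ Icc 0 (k * η + η), X i (T i) ≤ X j s := fun j s hs =>
          (hi j).trans (hTm j s hs)
        set t := T i with ht
        have htI := hT i
        rw [← ht] at htI
        have hneg : X i t < 0 := by
          refine (hall i₁ t₁ ⟨ht₁0, ht₁'⟩).trans_lt ?_
          simp only [X, max_eq_left ht₁0]; exact hi₁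
        have htk : k * η < t := by
          by_contra h
          push Not at h
          have := (ih t (by linarith [htI.1]) h).1 i
          simp only [X, max_eq_left htI.1] at hneg
          linarith
        have ht0 : 0 < t := by linarith
        set m := - X i t with hm
        have hm0 : 0 < m := by linarith
        set b := max 0 (t - η) with hb
        have hbk : b ≤ k * η := max_le hkη (by linarith [htI.2])
        have hbη : t - b ≤ η := by
          have := le_max_right 0 (t - η); linarith
        have hbt : b < t := by linarith
        have hex := extremum hα (hXc i) (hFc i) hc0 (hK i) (t := t) (b := b) (m := m)
          (le_max_left _ _) hbt hm0.le
          (fun r hr => hall i r ⟨hr.1, hr.2.trans htI.2⟩)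
          (fun r hr => by
            have := (ih r (by linarith [hr.1]) (hr.2.trans hbk)).1 i
            simp only [hm, add_neg_cancel]
            simp only [X, max_eq_left hr.1]; exact this)
        have hpow : η ^ (-α) ≤ (t - b) ^ (-α) :=
          Real.rpow_le_rpow_of_nonpos (by linarith) hbη (by linarith)
        have hup : F i t < -(m * L) := by
          have h1 : c * η ^ (-α) ≤ c * (t - b) ^ (-α) := mul_le_mul_of_nonneg_left hpow hc0.le
          have h2 : m * L < m * (c * (t - b) ^ (-α)) :=
            mul_lt_mul_of_pos_left (hηL.trans_le h1) hm0
          linarith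
        have hBx := hmv B (x (t - τ₁)) hB
          (ih (t - τ₁) (by linarith) (by linarith [htI.2])).1 i
        have hEy := hmv E (y (t - τ₂)) hE
          (ih (t - τ₂) (by linarith) (by linarith [htI.2])).2 i
        have hAx : -(m * L) ≤ A.mulVec (x t) i := by
          have h1 : ∑ j, |A i j| ≤ L :=
            Finset.single_le_sum (f := fun i => ∑ j, |A i j|)
              (fun i _ => Finset.sum_nonneg fun j _ => abs_nonneg _) (Finset.mem_univ i)
          have h2 : -(m * ∑ j, |A i j|) ≤ A.mulVec (x t) i := by
            rw [Finset.mul_sum, ← Finset.sum_neg_distrib]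
            apply Finset.sum_le_sum
            intro j _
            have hj := hall j t htI
            simp only [X, max_eq_left ht0.le] at hj
            have hmx : m = - x t i := by simp only [hm, X, max_eq_left ht0.le]
            by_cases hij : i = j
            · subst hij
              have h3 := le_abs_self (A i i)
              have : x t i = -m := by linarith
              rw [this]; nlinarith
            · rw [abs_of_nonneg (hA i j hij)]
              have := hA i j hij
              have hj' : -m ≤ x t j := by linarith
              nlinarith
          nlinarith
        have hFe : F i t = A.mulVec (x t) i + B.mulVec (x (t - τ₁)) i + E.mulVec (y (t - τ₂)) i := by
          simp only [F, max_eq_left ht0.le, Pi.add_apply]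
        linarith
      intro t h1 h2
      refine ⟨hxpos t h1 h2, ?_⟩
      rcases le_total t 0 with h | h
      · exact (ih t h1 (by linarith)).2
      · intro i
        rw [halg t h]
        have a1 := hmv C (x t) hC (hxpos t h1 h2) i
        have a2 := hmv D (y (t - τ₃)) hD (ih (t - τ₃) (by linarith) (by linarith)).2 i
        simp only [Pi.add_apply]
        linarith
  intro t ht
  obtain ⟨k, hk⟩ := exists_nat_ge (t / η)
  exact key k t (by linarith) (by rwa [div_le_iff₀ hη0] at hk)
end
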